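/- arXiv:2104.06971 — 2 statements merged into one kernel-verified Lean document; each statement's English description precedes it below -/
import Mathlib

section
/- For every integer r ≥ 3 there exists a constant c_r > 0 such that every K_r-free, d-degenerate finite simple graph with m edges (d ≥ 1) has surplus at least c_r · m / d^(1 − 1/(r−1)). -/
namespace MaxCutPaper

variable {V : Type*}

/-- The size of the cut induced by a vertex subset `S`: the number of edges of `G`
with one endpoint in `S` and the other outside `S` (counted via ordered pairs with
first coordinate in `S`). -/
noncomputable def cutSize [Fintype V] (G : SimpleGraph V) (S : Finset V) : ℕ :=
  Nat.card {p : V × V // p.1 ∈ S ∧ p.2 ∉ S ∧ G.Adj p.1 p.2}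

/-- The maximum size of a cut of `G`. -/
noncomputable def maxCut [Fintype V] (G : SimpleGraph V) : ℕ :=
  (Finset.univ : Finset V).powerset.sup (cutSize G)

/-- The number of edges of `G`. -/
noncomputable def edgeCount (G : SimpleGraph V) : ℕ := Nat.card G.edgeSet

/-- The surplus of `G`: `mc(G) - e(G)/2`. -/
noncomputable def surplus [Fintype V] (G : SimpleGraph V) : ℝ :=
  (maxCut G : ℝ) - (edgeCount G : ℝ) / 2

/-- The degree of a vertex. -/
noncomputable def degC (G : SimpleGraph V) (v : V) : ℕ := Nat.card (G.neighborSet v)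

/-- The number of copies of `K_r` in `G`, i.e. `r`-element sets of pairwise adjacent
vertices. -/
noncomputable def cliqueCount (G : SimpleGraph V) (r : ℕ) : ℕ :=
  Nat.card {s : Finset V // G.IsNClique r s}

/-- `G` contains no cycle of length `r`. -/
def CycleFree (G : SimpleGraph V) (r : ℕ) : Prop :=
  ∀ ⦃v : V⦄ (w : G.Walk v v), w.IsCycle → w.length ≠ r

/-- `G` is `d`-degenerate (for a real `d ≥ 0`): every (induced) subgraph has a vertex of
degree at most `d`. -/
def Degenerate (G : SimpleGraph V) (d : ℝ) : Prop :=
  ∀ B : Finset V, B.Nonempty → ∃ v ∈ B, (Nat.card {u : V // u ∈ B ∧ G.Adj v u} : ℝ) ≤ d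

/-- The number of edges of `G` with both endpoints in `T`. -/
noncomputable def edgesIn (G : SimpleGraph V) (T : Finset V) : ℝ :=
  (Nat.card {p : V × V // p.1 ∈ T ∧ p.2 ∈ T ∧ G.Adj p.1 p.2} : ℝ) / 2

/-- The sign attached to a Boolean. -/
def boolSign (b : Bool) : ℝ := if b then 1 else -1

lemma boolSign_not (b : Bool) : boolSign (!b) = -boolSign b := by
  cases b <;> simp [boolSign]

lemma boolSign_mul_self (b : Bool) : boolSign b * boolSign b = 1 := by
  cases b <;> simp [boolSign]

lemma abs_boolSign (b : Bool) : |boolSign b| = 1 := by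
  cases b <;> simp [boolSign]

section Mean

lemma half_mem_unitInterval : ∀ _ : V, (0 : ℝ) ≤ 1 / 2 ∧ (1 / 2 : ℝ) ≤ 1 := fun _ => by norm_num

variable [Fintype V] [DecidableEq V]

/-- The expectation of `F` when the coordinates of its argument are independent and the
coordinate `v` is `true` with probability `p v`. -/
noncomputable def biasedMean (p : V → ℝ) (F : (V → Bool) → ℝ) : ℝ :=
  ∑ σ, (∏ v, if σ v then p v else 1 - p v) * F σ

lemma biasedMean_add (p : V → ℝ) (F F' : (V → Bool) → ℝ) :
    biasedMean p (fun σ => F σ + F' σ) = biasedMean p F + biasedMean p F' := by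
  simp [biasedMean, mul_add, Finset.sum_add_distrib]

lemma biasedMean_const_mul (p : V → ℝ) (a : ℝ) (F : (V → Bool) → ℝ) :
    biasedMean p (fun σ => a * F σ) = a * biasedMean p F := by
  simp only [biasedMean, Finset.mul_sum]
  exact Finset.sum_congr rfl fun σ _ => by ring

lemma biasedMean_sub (p : V → ℝ) (F F' : (V → Bool) → ℝ) :
    biasedMean p (fun σ => F σ - F' σ) = biasedMean p F - biasedMean p F' := by
  simp [biasedMean, mul_sub, Finset.sum_sub_distrib]

lemma biasedMean_sum {ι : Type*} (p : V → ℝ) (s : Finset ι) (F : ι → (V → Bool) → ℝ) :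
    biasedMean p (fun σ => ∑ i ∈ s, F i σ) = ∑ i ∈ s, biasedMean p (F i) := by
  simp only [biasedMean, Finset.mul_sum]
  exact Finset.sum_comm

lemma biasedMean_mono {p : V → ℝ} (hp : ∀ v, 0 ≤ p v ∧ p v ≤ 1) {F F' : (V → Bool) → ℝ}
    (h : ∀ σ, F σ ≤ F' σ) : biasedMean p F ≤ biasedMean p F' := by
  refine Finset.sum_le_sum fun σ _ => mul_le_mul_of_nonneg_left (h σ) ?_
  refine Finset.prod_nonneg fun v _ => ?_
  split_ifs <;> linarith [hp v]

lemma biasedMean_prod_univ (p : V → ℝ) (g : V → Bool → ℝ) :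
    biasedMean p (fun σ => ∏ v, g v (σ v)) =
      ∏ v, (p v * g v true + (1 - p v) * g v false) := by
  have h := Finset.prod_univ_sum (fun _ : V => (Finset.univ : Finset Bool))
    (fun v b => (if b then p v else 1 - p v) * g v b)
  simp only [Fintype.sum_bool, if_true, Bool.false_eq_true, if_false] at h
  rw [h, Fintype.piFinset_univ]
  simp only [biasedMean, Finset.prod_mul_distrib]

lemma biasedMean_prod (p : V → ℝ) (s : Finset V) (g : V → Bool → ℝ) :
    biasedMean p (fun σ => ∏ v ∈ s, g v (σ v)) =
      ∏ v ∈ s, (p v * g v true + (1 - p v) * g v false) := by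
  have h := biasedMean_prod_univ p (fun v b => if v ∈ s then g v b else 1)
  have h₂ : ∀ v, (p v * (if v ∈ s then g v true else 1)
      + (1 - p v) * (if v ∈ s then g v false else 1)) =
      if v ∈ s then p v * g v true + (1 - p v) * g v false else 1 := by
    intro v; split_ifs <;> ring
  simp only [h₂] at h
  simpa [Finset.prod_ite_mem] using h

lemma biasedMean_const (p : V → ℝ) (a : ℝ) : biasedMean p (fun _ => a) = a := by
  have h := biasedMean_prod p ∅ (fun _ _ => 1)
  have h₂ := biasedMean_const_mul p a (fun _ => 1)
  simp only [Finset.prod_empty] at h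
  simpa [h] using h₂

lemma exists_le_biasedMean {p : V → ℝ} (hp : ∀ v, 0 ≤ p v ∧ p v ≤ 1)
    (F : (V → Bool) → ℝ) : ∃ σ, F σ ≤ biasedMean p F := by
  obtain ⟨σ, hσ⟩ := Finite.exists_min F
  refine ⟨σ, ?_⟩
  rw [← biasedMean_const p (F σ)]
  exact biasedMean_mono hp hσ

lemma exists_biasedMean_le {p : V → ℝ} (hp : ∀ v, 0 ≤ p v ∧ p v ≤ 1)
    (F : (V → Bool) → ℝ) : ∃ σ, biasedMean p F ≤ F σ := by
  obtain ⟨σ, hσ⟩ := Finite.exists_max F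
  refine ⟨σ, ?_⟩
  rw [← biasedMean_const p (F σ)]
  exact biasedMean_mono hp hσ

lemma biasedMean_sign_mul_sign (p : V → ℝ) {u v : V} (h : u ≠ v) :
    biasedMean p (fun σ => boolSign (σ u) * boolSign (σ v)) =
      (2 * p u - 1) * (2 * p v - 1) := by
  have h₂ := biasedMean_prod p {u, v} (fun _ => boolSign)
  simp only [Finset.prod_pair h, boolSign, if_true, Bool.false_eq_true, if_false] at h₂
  simp only [boolSign]
  rw [h₂]; ring

/-- Expectation over independent uniform signs. -/
noncomputable def fairMean (F : (V → Bool) → ℝ) : ℝ := biasedMean (fun _ => 1 / 2) F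

lemma fairMean_sign_mul_sign (u v : V) :
    fairMean (fun σ => boolSign (σ u) * boolSign (σ v)) = if u = v then 1 else 0 := by
  split_ifs with h
  · subst h
    simp only [boolSign_mul_self, fairMean, biasedMean_const]
  · rw [fairMean, biasedMean_sign_mul_sign _ h]; norm_num

end Mean

section Flip

variable [DecidableEq V]

/-- Negate the coordinates of `σ` in `A`. -/
def flipOn (A : Finset V) (σ : V → Bool) : V → Bool := fun v => if v ∈ A then !σ v else σ v

lemma flipOn_involutive (A : Finset V) : Function.Involutive (flipOn A) := by
  intro σ; funext v; by_cases h : v ∈ A <;> simp [flipOn, h]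

lemma fairMean_flipOn [Fintype V] (A : Finset V) (F : (V → Bool) → ℝ) :
    fairMean (fun σ => F (flipOn A σ)) = fairMean F := by
  have hw : ∀ σ : V → Bool, (∏ v, if σ v then (1 / 2 : ℝ) else 1 - 1 / 2) =
      ∏ _v : V, (1 / 2 : ℝ) :=
    fun σ => Finset.prod_congr rfl fun v _ => by split_ifs <;> norm_num
  simp only [fairMean, biasedMean, hw]
  exact Equiv.sum_comp (flipOn_involutive A).toPerm
    (fun σ => (∏ _v : V, (1 / 2 : ℝ)) * F σ)

/-- The sum of the signs of `σ` over `B`. -/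
def signSum (B : Finset V) (σ : V → Bool) : ℝ := ∑ v ∈ B, boolSign (σ v)

lemma signSum_flipOn_of_disjoint {A B : Finset V} (h : Disjoint A B) (σ : V → Bool) :
    signSum B (flipOn A σ) = signSum B σ := by
  refine Finset.sum_congr rfl fun v hv => ?_
  simp [flipOn, Finset.disjoint_right.mp h hv]

lemma signSum_flipOn_self (A : Finset V) (σ : V → Bool) :
    signSum A (flipOn A σ) = -signSum A σ := by
  rw [signSum, signSum, ← Finset.sum_neg_distrib]
  refine Finset.sum_congr rfl fun v hv => ?_
  simp [flipOn, hv, boolSign_not]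

lemma signSum_inter_add_sdiff (B C : Finset V) (σ : V → Bool) :
    signSum B σ = signSum (B ∩ C) σ + signSum (B \ C) σ :=
  (Finset.sum_inter_add_sum_sdiff B C _).symm

lemma fairMean_signSum_sq [Fintype V] (B : Finset V) :
    fairMean (fun σ => signSum B σ ^ 2) = B.card := by
  have h : ∀ σ, signSum B σ ^ 2 = ∑ u ∈ B, ∑ v ∈ B, boolSign (σ u) * boolSign (σ v) := by
    intro σ; rw [sq, signSum, Finset.sum_mul_sum]
  simp only [h, fairMean, biasedMean_sum]
  have h₂ := fun u v : V => fairMean_sign_mul_sign u v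
  simp only [fairMean] at h₂
  simp only [h₂, Finset.sum_ite_eq]
  simp

end Flip

/-- The truncation of a real number to `[-1, 1]`. -/
noncomputable def clamp (x : ℝ) : ℝ := max (-1) (min 1 x)

lemma clamp_neg (x : ℝ) : clamp (-x) = -clamp x := by
  unfold clamp; grind

lemma abs_clamp_le (x : ℝ) : |clamp x| ≤ 1 := by
  unfold clamp; grind

lemma clamp_mono {x y : ℝ} (h : x ≤ y) : clamp x ≤ clamp y := by
  unfold clamp; grind

lemma clamp_of_abs_le {x : ℝ} (h : |x| ≤ 1) : clamp x = x := by
  unfold clamp; grind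

lemma abs_clamp_sub_le (x y : ℝ) : |clamp x - clamp y| ≤ |x - y| := by
  unfold clamp; grind

lemma abs_clamp_add_clamp_le (x y : ℝ) : |clamp (x + y) + clamp (x - y)| ≤ 2 * |x| := by
  have h := abs_clamp_sub_le (x + y) (-(x - y))
  rw [clamp_neg] at h
  have : x + y - -(x - y) = 2 * x := by ring
  rw [this, abs_mul, abs_two] at h
  simpa using h

lemma clamp_increment_ge {ε κ R : ℝ} (hε : 0 < ε) (hκ : 0 < κ) (h : (κ + 1) * ε ≤ 1) :
    2 * ε * (1 - R ^ 2 / κ ^ 2) ≤ clamp (ε * (R + 1)) - clamp (ε * (R - 1)) := by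
  by_cases hR : |R| ≤ κ
  · have h₁ := abs_le.mp hR
    rw [clamp_of_abs_le, clamp_of_abs_le]
    · have : 0 ≤ R ^ 2 / κ ^ 2 := by positivity
      nlinarith
    · rw [abs_le]; constructor <;> nlinarith
    · rw [abs_le]; constructor <;> nlinarith
  · have h₁ : 1 ≤ R ^ 2 / κ ^ 2 := by
      rw [one_le_div (by positivity), ← sq_abs R]
      nlinarith [not_le.mp hR]
    have h₂ : clamp (ε * (R - 1)) ≤ clamp (ε * (R + 1)) := clamp_mono (by nlinarith)
    nlinarith

section Correlation

variable [Fintype V] [DecidableEq V]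

lemma fairMean_clamp_mul_clamp_le (ε : ℝ) (B B' : Finset V) :
    fairMean (fun σ => clamp (ε * signSum B σ) * clamp (ε * signSum B' σ)) ≤
      ε ^ 2 * (B ∩ B').card := by
  set F : (V → Bool) → ℝ := fun σ => clamp (ε * signSum B σ) * clamp (ε * signSum B' σ) with hF
  set A := B \ B'
  set A' := B' \ B
  have hAB' : Disjoint A B' := Finset.sdiff_disjoint
  have hA'B : Disjoint A' B := Finset.sdiff_disjoint
  have hAC : Disjoint A (B ∩ B') := hAB'.mono_right Finset.inter_subset_right
  have hA'C : Disjoint A' (B ∩ B') := hA'B.mono_right Finset.inter_subset_left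
  have hs : ∀ σ, signSum B σ = signSum (B ∩ B') σ + signSum A σ :=
    signSum_inter_add_sdiff B B'
  have hs' : ∀ σ, signSum B' σ = signSum (B ∩ B') σ + signSum A' σ := fun σ => by
    rw [signSum_inter_add_sdiff B' B, Finset.inter_comm]
  have key : ∀ σ, F σ + F (flipOn A σ) + (F (flipOn A' σ) + F (flipOn A (flipOn A' σ))) ≤
      4 * (ε ^ 2 * signSum (B ∩ B') σ ^ 2) := by
    intro σ
    have e₁ : ∀ σ, signSum B (flipOn A σ) = signSum (B ∩ B') σ - signSum A σ := fun σ => by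
      rw [hs, signSum_flipOn_of_disjoint hAC, signSum_flipOn_self, sub_eq_add_neg]
    have e₂ : signSum B' (flipOn A' σ) = signSum (B ∩ B') σ - signSum A' σ := by
      rw [hs', signSum_flipOn_of_disjoint hA'C, signSum_flipOn_self, sub_eq_add_neg]
    have e₃ : signSum (B ∩ B') (flipOn A' σ) = signSum (B ∩ B') σ :=
      signSum_flipOn_of_disjoint hA'C σ
    have e₄ : signSum A (flipOn A' σ) = signSum A σ :=
      signSum_flipOn_of_disjoint (hA'B.mono_right Finset.sdiff_subset) σ
    simp only [hF, signSum_flipOn_of_disjoint hAB', signSum_flipOn_of_disjoint hA'B, e₁, e₂, e₃,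
      e₄, hs σ, hs' σ, mul_add, mul_sub]
    set X := ε * signSum (B ∩ B') σ with hX
    set Y := ε * signSum A σ
    set Z := ε * signSum A' σ
    have h₁ := abs_clamp_add_clamp_le X Y
    have h₂ := abs_clamp_add_clamp_le X Z
    have h₃ := mul_le_mul h₁ h₂ (abs_nonneg _) (by positivity)
    rw [← abs_mul] at h₃
    have h₄ := (le_abs_self _).trans h₃
    have h₅ : 2 * |X| * (2 * |X|) = 4 * X ^ 2 := by rw [← sq_abs X]; ring
    rw [h₅] at h₄
    have h₆ : ε ^ 2 * signSum (B ∩ B') σ ^ 2 = X ^ 2 := by rw [hX]; ring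
    rw [h₆]
    linarith
  have hm := biasedMean_mono half_mem_unitInterval key
  rw [biasedMean_add, biasedMean_add, biasedMean_add, biasedMean_const_mul,
    biasedMean_const_mul] at hm
  have f₁ := fairMean_flipOn A F
  have f₂ := fairMean_flipOn A' F
  have f₃ := fairMean_flipOn A' (fun σ => F (flipOn A σ))
  have f₄ := fairMean_signSum_sq (B ∩ B')
  simp only [fairMean] at f₁ f₂ f₃ f₄ ⊢
  rw [f₃, f₂, f₁, f₄] at hm
  linarith

lemma fairMean_sign_mul_clamp_of_notMem (ε : ℝ) {B : Finset V} {u : V} (hu : u ∉ B) :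
    fairMean (fun σ => boolSign (σ u) * clamp (ε * signSum B σ)) = 0 := by
  have h := fairMean_flipOn {u} (fun σ => boolSign (σ u) * clamp (ε * signSum B σ))
  have h₂ : ∀ σ, boolSign (flipOn {u} σ u) * clamp (ε * signSum B (flipOn {u} σ)) =
      (-1) * (boolSign (σ u) * clamp (ε * signSum B σ)) := fun σ => by
    rw [signSum_flipOn_of_disjoint (by simpa using hu)]
    simp [flipOn, boolSign_not]
  simp only [h₂] at h
  rw [fairMean, biasedMean_const_mul] at h
  rw [fairMean] at h ⊢
  linarith

lemma fairMean_sign_mul_clamp_of_mem {ε D : ℝ} (hε : 0 < ε) (hD : 0 < D)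
    (hεD : (2 * √D + 1) * ε ≤ 1) {B : Finset V} (hB : (B.card : ℝ) ≤ D) {u : V} (hu : u ∈ B) :
    3 / 4 * ε ≤ fairMean (fun σ => boolSign (σ u) * clamp (ε * signSum B σ)) := by
  have h := fairMean_flipOn {u} (fun σ => boolSign (σ u) * clamp (ε * signSum B σ))
  have hs : ∀ σ, signSum B σ = signSum (B.erase u) σ + boolSign (σ u) := fun σ =>
    (Finset.sum_erase_add B _ hu).symm
  have hd : Disjoint {u} (B.erase u) := by simp
  have key : ∀ σ, 2 * ε - (2 * ε / (2 * √D) ^ 2) * signSum (B.erase u) σ ^ 2 ≤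
      boolSign (σ u) * clamp (ε * signSum B σ) +
      boolSign (flipOn {u} σ u) * clamp (ε * signSum B (flipOn {u} σ)) := by
    intro σ
    have h₁ := clamp_increment_ge (R := signSum (B.erase u) σ) hε
      (show 0 < 2 * √D by positivity) hεD
    have h₂ : 2 * ε - (2 * ε / (2 * √D) ^ 2) * signSum (B.erase u) σ ^ 2 =
      2 * ε * (1 - signSum (B.erase u) σ ^ 2 / (2 * √D) ^ 2) := by ring
    rw [h₂, hs (flipOn _ _), hs, signSum_flipOn_of_disjoint hd]
    refine h₁.trans (le_of_eq ?_)
    cases hσ : σ u <;> simp [flipOn, hσ, boolSign] <;> ring_nf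
  have hm := biasedMean_mono half_mem_unitInterval key
  rw [biasedMean_add, biasedMean_sub, biasedMean_const,
    biasedMean_const_mul _ (2 * ε / (2 * √D) ^ 2)] at hm
  have f := fairMean_signSum_sq (B.erase u)
  simp only [fairMean] at h f ⊢
  rw [h, f] at hm
  have hc : ((B.erase u).card : ℝ) ≤ D :=
    le_trans (by exact_mod_cast Finset.card_le_card (Finset.erase_subset u B)) hB
  have h₃ : 2 * ε / (2 * √D) ^ 2 * ((B.erase u).card : ℝ) ≤ ε / 2 := by
    rw [mul_pow, Real.sq_sqrt hD.le, div_mul_eq_mul_div, div_le_iff₀ (by positivity)]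
    nlinarith
  linarith

end Correlation

section SignForm

variable [Fintype V]

open scoped Classical in
/-- The quadratic form `∑ τ u * τ v` over the ordered pairs of adjacent vertices. -/
noncomputable def signForm (G : SimpleGraph V) (τ : V → ℝ) : ℝ :=
  ∑ u, ∑ v, if G.Adj u v then τ u * τ v else 0

variable [DecidableEq V]

open scoped Classical in
lemma biasedMean_signForm (p : V → ℝ) (G : SimpleGraph V) (f : (V → Bool) → V → ℝ) :
    biasedMean p (fun σ => signForm G (f σ)) =
      ∑ u, ∑ v, if G.Adj u v then biasedMean p (fun σ => f σ u * f σ v) else 0 := by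
  simp only [signForm, biasedMean_sum]
  refine Finset.sum_congr rfl fun u _ => Finset.sum_congr rfl fun v _ => ?_
  split_ifs
  · rfl
  · exact biasedMean_const p 0

lemma exists_boolSign_signForm_le (G : SimpleGraph V) {τ : V → ℝ} (hτ : ∀ v, |τ v| ≤ 1) :
    ∃ σ : V → Bool, signForm G (fun v => boolSign (σ v)) ≤ signForm G τ := by
  have hp : ∀ v, 0 ≤ (1 + τ v) / 2 ∧ (1 + τ v) / 2 ≤ 1 := fun v => by
    have := abs_le.mp (hτ v)
    constructor <;> linarith
  obtain ⟨σ, hσ⟩ := exists_le_biasedMean hp (fun σ => signForm G (fun v => boolSign (σ v)))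
  refine ⟨σ, hσ.trans (le_of_eq ?_)⟩
  rw [biasedMean_signForm, signForm]
  refine Finset.sum_congr rfl fun u _ => Finset.sum_congr rfl fun v _ => ?_
  split_ifs with h
  · rw [biasedMean_sign_mul_sign _ h.ne]; ring
  · rfl

lemma fairMean_perturbed_mul_le {ε D : ℝ} (hε : 0 < ε) (hD : 0 < D)
    (hεD : (2 * √D + 1) * ε ≤ 1) {B : V → Finset V} (hB : ∀ v, ((B v).card : ℝ) ≤ D)
    {u v : V} (huv : u ≠ v) :
    fairMean (fun σ => (boolSign (σ u) - clamp (ε * signSum (B u) σ)) / 2 *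
        ((boolSign (σ v) - clamp (ε * signSum (B v) σ)) / 2)) ≤
      1 / 4 * (ε ^ 2 * (B u ∩ B v).card - 3 / 4 * ε * (if u ∈ B v then 1 else 0)
        - 3 / 4 * ε * (if v ∈ B u then 1 else 0)) := by
  have hsc : ∀ u v : V, 3 / 4 * ε * (if u ∈ B v then 1 else 0) ≤
      fairMean (fun σ => boolSign (σ u) * clamp (ε * signSum (B v) σ)) := by
    intro u v
    split_ifs with h
    · rw [mul_one]
      exact fairMean_sign_mul_clamp_of_mem hε hD hεD (hB v) h
    · rw [fairMean_sign_mul_clamp_of_notMem ε h, mul_zero]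
  have hcc := fairMean_clamp_mul_clamp_le ε (B u) (B v)
  have hss := fairMean_sign_mul_sign u v
  rw [if_neg huv] at hss
  have h₁ := hsc u v
  have h₂ := hsc v u
  have e : ∀ σ : V → Bool, (boolSign (σ u) - clamp (ε * signSum (B u) σ)) / 2 *
      ((boolSign (σ v) - clamp (ε * signSum (B v) σ)) / 2) =
      1 / 4 * (boolSign (σ u) * boolSign (σ v)
        + clamp (ε * signSum (B u) σ) * clamp (ε * signSum (B v) σ)
        - boolSign (σ u) * clamp (ε * signSum (B v) σ)
        - boolSign (σ v) * clamp (ε * signSum (B u) σ)) := fun σ => by ring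
  simp only [e, fairMean] at hcc hss h₁ h₂ ⊢
  rw [biasedMean_const_mul, biasedMean_sub, biasedMean_sub, biasedMean_add]
  linarith

open scoped Classical in
lemma exists_signForm_le_of_lists (G : SimpleGraph V) {ε D : ℝ} (hε : 0 < ε) (hD : 0 < D)
    (hεD : (2 * √D + 1) * ε ≤ 1) {B : V → Finset V} (hB : ∀ v, ((B v).card : ℝ) ≤ D)
    (hBG : ∀ v, ∀ u ∈ B v, G.Adj v u) :
    ∃ τ : V → ℝ, (∀ v, |τ v| ≤ 1) ∧ signForm G τ ≤
      1 / 4 * (ε ^ 2 * (∑ u, ∑ v, if G.Adj u v then ((B u ∩ B v).card : ℝ) else 0)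
        - 3 / 2 * ε * ∑ v, ((B v).card : ℝ)) := by
  obtain ⟨σ, hσ⟩ := exists_le_biasedMean half_mem_unitInterval (fun σ => signForm G
    (fun v => (boolSign (σ v) - clamp (ε * signSum (B v) σ)) / 2))
  refine ⟨_, fun v => ?_, hσ.trans ?_⟩
  · have h₁ := abs_le.mp (abs_boolSign (σ v)).le
    have h₂ := abs_le.mp (abs_clamp_le (ε * signSum (B v) σ))
    rw [abs_le]; constructor <;> linarith
  have hcard : ∀ v, ((B v).card : ℝ) = ∑ u, if u ∈ B v then (1 : ℝ) else 0 := fun v => by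
    simp
  have h : ∀ u v, (if G.Adj u v then biasedMean (fun _ => 1 / 2) (fun σ =>
      (boolSign (σ u) - clamp (ε * signSum (B u) σ)) / 2 *
        ((boolSign (σ v) - clamp (ε * signSum (B v) σ)) / 2)) else 0) ≤
      1 / 4 * (ε ^ 2 * (if G.Adj u v then ((B u ∩ B v).card : ℝ) else 0)
        - 3 / 4 * ε * (if u ∈ B v then 1 else 0) - 3 / 4 * ε * (if v ∈ B u then 1 else 0)) := by
    intro u v
    by_cases hA : G.Adj u v
    · simp only [if_pos hA]
      exact fairMean_perturbed_mul_le hε hD hεD hB hA.ne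
    · have h₁ : u ∉ B v := fun h => hA (hBG v u h).symm
      have h₂ : v ∉ B u := fun h => hA (hBG u v h)
      simp [hA, h₁, h₂]
  rw [biasedMean_signForm]
  refine (Finset.sum_le_sum fun u _ => Finset.sum_le_sum fun v _ => h u v).trans (le_of_eq ?_)
  have hcomm : (∑ u, ∑ v, if u ∈ B v then (1 : ℝ) else 0) = ∑ v, ((B v).card : ℝ) := by
    rw [Finset.sum_comm]; simp only [hcard]
  simp only [← Finset.mul_sum, Finset.sum_sub_distrib]
  rw [hcomm]
  simp only [← hcard]
  ring

/-- The spanning subgraph of `G` whose edges are those with both ends in `U`. -/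
def restrictTo (G : SimpleGraph V) (U : Finset V) : SimpleGraph V where
  Adj u v := G.Adj u v ∧ u ∈ U ∧ v ∈ U
  symm := ⟨fun _ _ h => ⟨h.1.symm, h.2.2, h.2.1⟩⟩
  loopless := ⟨fun _ h => h.1.ne rfl⟩

open scoped Classical in
lemma exists_signForm_le_sum_restrictTo (G : SimpleGraph V) (U : V → Finset V)
    (hU : ∀ v w w', v ∈ U w → v ∈ U w' → w = w') (τ : V → V → ℝ) (hτ : ∀ w v, |τ w v| ≤ 1) :
    ∃ τ' : V → ℝ, (∀ v, |τ' v| ≤ 1) ∧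
      signForm G τ' ≤ ∑ w, signForm (restrictTo G (U w)) (τ w) := by
  set a : V → V → ℝ := fun w v => if v ∈ U w then τ w v else 0 with ha
  obtain ⟨ρ, hρ⟩ := exists_le_biasedMean half_mem_unitInterval (fun ρ => signForm G
    (fun v => ∑ w, boolSign (ρ w) * a w v))
  refine ⟨_, fun v => ?_, hρ.trans (le_of_eq ?_)⟩
  · by_cases h : ∃ w, v ∈ U w
    · obtain ⟨w, hw⟩ := h
      rw [Finset.sum_eq_single w]
      · rw [abs_mul, abs_boolSign, one_mul]
        simpa [ha, hw] using hτ w v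
      · intro w' _ hne
        have : v ∉ U w' := fun h' => hne (hU v w' w h' hw)
        simp [ha, this]
      · simp
    · have : ∀ w, a w v = 0 := fun w => if_neg fun hw => h ⟨w, hw⟩
      simp [this]
  · have hE : ∀ u v, biasedMean (fun _ => 1 / 2) (fun ρ : V → Bool =>
        (∑ w, boolSign (ρ w) * a w u) * ∑ w, boolSign (ρ w) * a w v) = ∑ w, a w u * a w v := by
      intro u v
      have e : ∀ ρ : V → Bool, (∑ w, boolSign (ρ w) * a w u) * (∑ w, boolSign (ρ w) * a w v) =
          ∑ w, ∑ w', a w u * a w' v * (boolSign (ρ w) * boolSign (ρ w')) := fun ρ => by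
        rw [Finset.sum_mul_sum]
        exact Finset.sum_congr rfl fun w _ => Finset.sum_congr rfl fun w' _ => by ring
      have h₂ := fun w w' : V => fairMean_sign_mul_sign w w'
      simp only [fairMean] at h₂
      simp only [e, biasedMean_sum, biasedMean_const_mul, h₂]
      simp
    rw [biasedMean_signForm]
    simp only [hE, signForm]
    have hr : ∀ u v, (if G.Adj u v then ∑ w, a w u * a w v else 0) =
        ∑ w, if (restrictTo G (U w)).Adj u v then τ w u * τ w v else 0 := by
      intro u v
      by_cases hA : G.Adj u v
      · rw [if_pos hA]
        refine Finset.sum_congr rfl fun w _ => ?_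
        by_cases h₁ : u ∈ U w <;> by_cases h₂ : v ∈ U w <;> simp [ha, restrictTo, hA, h₁, h₂]
      · simp [restrictTo, hA]
    simp only [hr]
    calc _ = ∑ u, ∑ w, ∑ v, (if (restrictTo G (U w)).Adj u v then τ w u * τ w v else 0) :=
          Finset.sum_congr rfl fun u _ => Finset.sum_comm
      _ = _ := Finset.sum_comm

end SignForm

section Sampling

variable [DecidableEq V]

lemma one_div_le_biasedMean_filter_eq [Fintype V] {D : ℝ} (hD : 1 ≤ D) {S T : Finset V} {w : V}
    (hS : (S.card : ℝ) ≤ D) (hT : (T.card : ℝ) ≤ D) (hwS : w ∈ S) (hwT : w ∈ T) :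
    1 / (8 * D) ≤ biasedMean (fun _ => 1 / (4 * D)) (fun W : V → Bool =>
      if S.filter (W · = true) = {w} ∧ T.filter (W · = true) = {w} then 1 else 0) := by
  set p := 1 / (4 * D) with hp
  have hD₀ : 0 < D := by linarith
  have hp₀ : 0 < p := by positivity
  have hp₁ : p ≤ 1 / 4 := by
    rw [hp]; exact one_div_le_one_div_of_le (by norm_num) (by linarith)
  have hp' : ∀ _ : V, 0 ≤ p ∧ p ≤ 1 := fun _ => ⟨hp₀.le, by linarith⟩
  set R := (S ∪ T).erase w with hR
  have hw : w ∈ S ∪ T := Finset.mem_union_left _ hwS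
  have hRcard : (R.card : ℝ) ≤ 2 * D := by
    have h₁ : R.card ≤ S.card + T.card :=
      (Finset.card_le_card (Finset.erase_subset _ _)).trans (Finset.card_union_le S T)
    have h₂ : (R.card : ℝ) ≤ S.card + T.card := by exact_mod_cast h₁
    linarith
  have hprod := biasedMean_prod (fun _ => p) (S ∪ T)
    (fun x b => if b = decide (x = w) then 1 else 0)
  have hval : ∏ x ∈ S ∪ T, (p * (if true = decide (x = w) then 1 else 0)
      + (1 - p) * (if false = decide (x = w) then 1 else 0)) = p * (1 - p) ^ R.card := by
    rw [← Finset.mul_prod_erase _ _ hw]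
    congr 1
    · simp
    · rw [← Finset.prod_const]
      refine Finset.prod_congr rfl fun x hx => ?_
      simp [Finset.ne_of_mem_erase hx]
  rw [hval] at hprod
  have hb : 1 / 2 ≤ (1 - p) ^ R.card := by
    have h := one_add_mul_le_pow (a := -p) (by linarith) R.card
    have h₂ : R.card * p ≤ 1 / 2 := by
      calc R.card * p ≤ 2 * D * p := by gcongr
        _ = 1 / 2 := by rw [hp]; field_simp; norm_num
    rw [← sub_eq_add_neg] at h
    linarith
  have hlow : 1 / (8 * D) ≤ p * (1 - p) ^ R.card := by
    have : 1 / (8 * D) = p * (1 / 2) := by rw [hp]; field_simp; norm_num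
    rw [this]; gcongr
  refine hlow.trans (hprod.symm.le.trans (biasedMean_mono hp' fun W => ?_))
  by_cases h : ∀ x ∈ S ∪ T, W x = decide (x = w)
  · have hf : ∀ A ⊆ S ∪ T, w ∈ A → A.filter (W · = true) = {w} := by
      intro A hA hwA
      ext x
      simp only [Finset.mem_filter, Finset.mem_singleton]
      constructor
      · rintro ⟨hx, hx'⟩
        simpa [h x (hA hx)] using hx'
      · rintro rfl
        exact ⟨hwA, by simpa using h x hw⟩
    rw [if_pos ⟨hf S Finset.subset_union_left hwS, hf T Finset.subset_union_right hwT⟩]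
    refine Finset.prod_le_one (fun x _ => ?_) fun x _ => ?_ <;> split_ifs <;> norm_num
  · push Not at h
    obtain ⟨x, hx, hx'⟩ := h
    rw [Finset.prod_eq_zero hx (by simp [hx'])]
    split_ifs <;> norm_num

/-- The vertices `v` for which `w` is the only element of `B v` selected by `W`. -/
def cluster [Fintype V] (B : V → Finset V) (W : V → Bool) (w : V) : Finset V :=
  Finset.univ.filter fun v => (B v).filter (W · = true) = {w}

lemma cluster_unique [Fintype V] (B : V → Finset V) (W : V → Bool) (v w w' : V)
    (h : v ∈ cluster B W w) (h' : v ∈ cluster B W w') : w = w' := by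
  simp only [cluster, Finset.mem_filter, Finset.mem_univ, true_and] at h h'
  exact Finset.singleton_injective (h.symm.trans h')

lemma mem_of_mem_cluster [Fintype V] {B : V → Finset V} {W : V → Bool} {v w : V}
    (h : v ∈ cluster B W w) : w ∈ B v := by
  simp only [cluster, Finset.mem_filter, Finset.mem_univ, true_and] at h
  have : w ∈ (B v).filter (W · = true) := by rw [h]; simp
  exact (Finset.mem_filter.mp this).1

lemma exists_cluster_sum_ge [Fintype V] {D : ℝ} (hD : 1 ≤ D) {B : V → Finset V}
    (hB : ∀ v, ((B v).card : ℝ) ≤ D) (L : V → V → Finset V)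
    (hL : ∀ w v, ∀ u ∈ L w v, w ∈ B u ∧ w ∈ B v) :
    ∃ W : V → Bool, 1 / (8 * D) * ∑ w, ∑ v, ((L w v).card : ℝ) ≤
      ∑ w, ∑ v, (((L w v).filter
        fun u => u ∈ cluster B W w ∧ v ∈ cluster B W w).card : ℝ) := by
  have hp : ∀ _ : V, 0 ≤ 1 / (4 * D) ∧ 1 / (4 * D) ≤ 1 := fun _ => by
    refine ⟨by positivity, ?_⟩
    rw [div_le_one (by linarith)]; linarith
  obtain ⟨W, hW⟩ := exists_biasedMean_le hp (fun W => ∑ w, ∑ v, (((L w v).filter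
        fun u => u ∈ cluster B W w ∧ v ∈ cluster B W w).card : ℝ))
  refine ⟨W, le_trans ?_ hW⟩
  simp only [Finset.card_filter, Nat.cast_sum, Nat.cast_ite, Nat.cast_one, Nat.cast_zero,
    biasedMean_sum, Finset.mul_sum]
  refine Finset.sum_le_sum fun w _ => Finset.sum_le_sum fun v _ => ?_
  rw [mul_comm, ← nsmul_eq_mul, ← Finset.sum_const]
  refine Finset.sum_le_sum fun u hu => ?_
  obtain ⟨h₁, h₂⟩ := hL w v u hu
  simpa [cluster] using one_div_le_biasedMean_filter_eq hD (hB u) (hB v) h₁ h₂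

end Sampling

section InductiveStep

open scoped Classical in
lemma exists_signForm_le_of_few_triangles {V : Type*} [Fintype V] [DecidableEq V]
    (G : SimpleGraph V) {D s : ℝ} (hD : 1 ≤ D) (hDs : √D ≤ s) {B : V → Finset V}
    (hB : ∀ v, ((B v).card : ℝ) ≤ D) (hBG : ∀ v, ∀ u ∈ B v, G.Adj v u)
    (hfew : ∀ u, ∀ w ∈ B u,
      ((Finset.univ.filter fun v => G.Adj u v ∧ w ∈ B v).card : ℝ) ≤ s) :
    ∃ τ : V → ℝ, (∀ v, |τ v| ≤ 1) ∧
      signForm G τ ≤ -(7 / 72 * (1 / s) * ∑ v, ((B v).card : ℝ)) := by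
  have hD₁ : 1 ≤ √D := Real.one_le_sqrt.mpr hD
  have hs : 0 < s := by linarith
  obtain ⟨τ, hτ, h⟩ := exists_signForm_le_of_lists G (ε := 1 / (3 * s)) (D := D)
    (by positivity) (by linarith) (by rw [mul_one_div, div_le_one (by positivity)]; linarith)
    hB hBG
  refine ⟨τ, hτ, h.trans ?_⟩
  have htri : (∑ u, ∑ v, if G.Adj u v then ((B u ∩ B v).card : ℝ) else 0) ≤
      s * ∑ v, ((B v).card : ℝ) := by
    rw [Finset.mul_sum]
    refine Finset.sum_le_sum fun u _ => ?_
    have e : ∀ v, (if G.Adj u v then ((B u ∩ B v).card : ℝ) else 0) =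
        ∑ w ∈ B u, if G.Adj u v ∧ w ∈ B v then (1 : ℝ) else 0 := by
      intro v
      by_cases hA : G.Adj u v
      · simp [hA]
      · simp [hA]
    simp only [e]
    rw [Finset.sum_comm, mul_comm, ← nsmul_eq_mul, ← Finset.sum_const]
    refine Finset.sum_le_sum fun w hw => ?_
    simpa using hfew u w hw
  have h₂ : (1 / (3 * s)) ^ 2 * (s * ∑ v, ((B v).card : ℝ)) =
      1 / 9 * (1 / s) * ∑ v, ((B v).card : ℝ) := by
    field_simp; ring
  have h₃ : 3 / 2 * (1 / (3 * s)) * ∑ v, ((B v).card : ℝ) =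
      1 / 2 * (1 / s) * ∑ v, ((B v).card : ℝ) := by
    field_simp
  have h₄ := mul_le_mul_of_nonneg_left htri (sq_nonneg (1 / (3 * s)))
  rw [h₂] at h₄
  rw [h₃]
  linarith

lemma cliqueFree_restrictTo {V : Type*} [DecidableEq V] {G : SimpleGraph V} {k : ℕ} (hk : 1 ≤ k)
    (hG : G.CliqueFree (k + 2)) {U : Finset V} {w : V} (hw : ∀ v ∈ U, G.Adj w v) :
    (restrictTo G U).CliqueFree (k + 1) := by
  intro t ht
  have htU : ∀ v ∈ t, v ∈ U := by
    intro v hv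
    obtain ⟨u, hu, huv⟩ := Finset.exists_mem_ne (by rw [ht.card_eq]; omega) v
    exact (ht.isClique hv hu huv.symm).2.1
  have ht' : G.IsNClique (k + 1) t := ⟨fun u hu v hv huv => (ht.isClique hu hv huv).1, ht.card_eq⟩
  exact hG _ (ht'.insert fun v hv => hw v (htU v hv))

/-- Every `K_{k+1}`-free graph has a sign assignment correlating negatively with its edges, to the
extent of `c * D ^ (1 / k - 1)` per edge of a subgraph of maximum outdegree at most `D`. -/
def HasNegativeForm (k : ℕ) (c : ℝ) : Prop :=
  ∀ (V : Type) [Fintype V] [DecidableEq V] (G : SimpleGraph V), G.CliqueFree (k + 1) →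
    ∀ (B : V → Finset V) (D : ℝ), 1 ≤ D → (∀ v, ((B v).card : ℝ) ≤ D) →
      (∀ v, ∀ u ∈ B v, G.Adj v u) →
      ∃ τ : V → ℝ, (∀ v, |τ v| ≤ 1) ∧
        signForm G τ ≤ -(c * (D ^ (1 / (k : ℝ)) / D) * ∑ v, ((B v).card : ℝ))

open scoped Classical in
lemma HasNegativeForm.exists_signForm_le_of_many_triangles {k : ℕ} (hk : 1 ≤ k) {c : ℝ}
    (hc : 0 < c) (ih : HasNegativeForm k c) {V : Type} [Fintype V] [DecidableEq V]
    {G : SimpleGraph V} (hG : G.CliqueFree (k + 2)) {D s : ℝ} (hD : 1 ≤ D) (hs : 1 ≤ s)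
    {B H : V → Finset V} (hB : ∀ v, ((B v).card : ℝ) ≤ D) (hBG : ∀ v, ∀ u ∈ B v, G.Adj v u)
    (hHB : ∀ v, H v ⊆ B v)
    (hmany : ∀ v, ∀ w ∈ H v,
      s ≤ ((Finset.univ.filter fun u => G.Adj v u ∧ w ∈ B u).card : ℝ)) :
    ∃ τ : V → ℝ, (∀ v, |τ v| ≤ 1) ∧
      signForm G τ ≤ -(c / 16 * (s ^ (1 / (k : ℝ)) / D) * ∑ v, ((H v).card : ℝ)) := by
  have hsub : ∀ w v, ∃ L : Finset V, (∀ u ∈ L, G.Adj v u ∧ w ∈ B u ∧ w ∈ B v) ∧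
      L.card = if w ∈ H v then ⌊s⌋₊ else 0 := by
    intro w v
    by_cases hw : w ∈ H v
    · obtain ⟨L, hL, hcard⟩ := Finset.exists_subset_card_eq (Nat.floor_le_of_le (hmany v w hw))
      refine ⟨L, fun u hu => ?_, by simpa [hw] using hcard⟩
      have := Finset.mem_filter.mp (hL hu)
      exact ⟨this.2.1, this.2.2, hHB v hw⟩
    · exact ⟨∅, by simp, by simp [hw]⟩
  choose L hL hLcard using hsub
  obtain ⟨W, hW⟩ := exists_cluster_sum_ge hD hB L fun w v u hu => (hL w v u hu).2
  set U := cluster B W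
  set L' : V → V → Finset V := fun w v => (L w v).filter fun u => u ∈ U w ∧ v ∈ U w
  have hfloor : (⌊s⌋₊ : ℝ) ≤ s := Nat.floor_le (by linarith)
  have hL'card : ∀ w v, ((L' w v).card : ℝ) ≤ s := by
    intro w v
    have h₁ : (L' w v).card ≤ (L w v).card := Finset.card_filter_le _ _
    have h₂ : (L w v).card ≤ ⌊s⌋₊ := by rw [hLcard]; split_ifs <;> simp
    exact le_trans (by exact_mod_cast h₁.trans h₂) hfloor
  have hex : ∀ w, ∃ τ : V → ℝ, (∀ v, |τ v| ≤ 1) ∧ signForm (restrictTo G (U w)) τ ≤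
      -(c * (s ^ (1 / (k : ℝ)) / s) * ∑ v, ((L' w v).card : ℝ)) := by
    intro w
    refine ih V _ (cliqueFree_restrictTo hk hG (w := w) fun v hv => ?_) (L' w) s hs (hL'card w)
      fun v u hu => ?_
    · exact (hBG v w (mem_of_mem_cluster hv)).symm
    · obtain ⟨h₁, h₂, h₃⟩ := Finset.mem_filter.mp hu
      exact ⟨(hL w v u h₁).1, h₃, h₂⟩
  choose τ hτ hform using hex
  obtain ⟨τ', hτ', hle⟩ := exists_signForm_le_sum_restrictTo G U (cluster_unique B W) τ hτ
  refine ⟨τ', hτ', hle.trans ((Finset.sum_le_sum fun w _ => hform w).trans ?_)⟩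
  rw [Finset.sum_neg_distrib, neg_le_neg_iff, ← Finset.mul_sum]
  have hcount : ∑ w, ∑ v, ((L w v).card : ℝ) = ⌊s⌋₊ * ∑ v, ((H v).card : ℝ) := by
    rw [Finset.sum_comm, Finset.mul_sum]
    refine Finset.sum_congr rfl fun v _ => ?_
    simp [hLcard, mul_comm]
  have hhalf : s / 2 ≤ ⌊s⌋₊ := by
    have h₁ := Nat.lt_floor_add_one s
    have h₂ : (1 : ℝ) ≤ ⌊s⌋₊ := by exact_mod_cast (Nat.one_le_floor_iff s).mpr hs
    linarith
  rw [hcount] at hW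
  have hM : 0 ≤ ∑ v, ((H v).card : ℝ) := Finset.sum_nonneg fun _ _ => by positivity
  have hs₀ : 0 < s := by linarith
  have hD₀ : 0 < D := by linarith
  have ht : 0 < s ^ (1 / (k : ℝ)) := by positivity
  have arith : ∀ t M N : ℝ, 0 < t → 0 ≤ M → 1 / (8 * D) * (⌊s⌋₊ * M) ≤ N →
      c / 16 * (t / D) * M ≤ c * (t / s) * N := by
    intro t M N ht hM hN
    calc c / 16 * (t / D) * M = c * (t / s) * (1 / (8 * D) * (s / 2 * M)) := by
          field_simp; ring
      _ ≤ c * (t / s) * (1 / (8 * D) * (⌊s⌋₊ * M)) := by gcongr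
      _ ≤ c * (t / s) * N := by gcongr
  exact arith _ _ _ ht hM hW

lemma hasNegativeForm_one : HasNegativeForm 1 1 := by
  intro V _ _ G hG B D _ _ hBG
  have hB : ∀ v, B v = ∅ := by
    intro v
    rw [Finset.eq_empty_iff_forall_notMem]
    intro u hu
    have := SimpleGraph.cliqueFree_two.mp hG
    subst this
    exact hBG v u hu
  exact ⟨fun _ => 0, by simp, by simp [signForm, hB]⟩

open scoped Classical in
lemma HasNegativeForm.succ {k : ℕ} (hk : 1 ≤ k) {c : ℝ} (hc : 0 < c) (ih : HasNegativeForm k c) :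
    HasNegativeForm (k + 1) (min (c / 32) (7 / 144)) := by
  intro V _ _ G hG B D hD hB hBG
  have hD₀ : 0 < D := by linarith
  have hk₀ : (0 : ℝ) < k := by exact_mod_cast hk
  set t : ℝ := D ^ (1 / ((k + 1 : ℕ) : ℝ)) with ht
  have ht₀ : 0 < t := by positivity
  set s : ℝ := D ^ ((k : ℝ) / (k + 1)) with hs
  have hsk : s ^ (1 / (k : ℝ)) = t := by
    rw [hs, ht, ← Real.rpow_mul hD₀.le]
    congr 1
    push_cast
    field_simp
  have hst : 1 / s = t / D := by
    have : s * t = D := by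
      rw [hs, ht, ← Real.rpow_add hD₀]
      convert Real.rpow_one D using 2
      push_cast
      field_simp
    rw [div_eq_div_iff (by positivity) hD₀.ne']
    linarith
  have hs₁ : 1 ≤ s := Real.one_le_rpow hD (by positivity)
  have hDs : √D ≤ s := by
    rw [Real.sqrt_eq_rpow]
    refine Real.rpow_le_rpow_of_exponent_le hD ?_
    rw [div_le_div_iff₀ (by norm_num) (by positivity)]
    have : (1 : ℝ) ≤ k := by exact_mod_cast hk
    linarith
  set light : V → V → Prop := fun v w =>
    ((Finset.univ.filter fun u => G.Adj v u ∧ w ∈ B u).card : ℝ) ≤ s with hlight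
  set L : V → Finset V := fun v => (B v).filter (light v)
  set H : V → Finset V := fun v => (B v).filter fun w => ¬light v w
  have hLB : ∀ v, L v ⊆ B v := fun v => Finset.filter_subset _ _
  have hHB : ∀ v, H v ⊆ B v := fun v => Finset.filter_subset _ _
  have hsum : ∑ v, ((L v).card : ℝ) + ∑ v, ((H v).card : ℝ) = ∑ v, ((B v).card : ℝ) := by
    rw [← Finset.sum_add_distrib]
    refine Finset.sum_congr rfl fun v _ => ?_
    exact_mod_cast Finset.card_filter_add_card_filter_not (s := B v) (light v)
  have hM : 0 ≤ ∑ v, ((B v).card : ℝ) := Finset.sum_nonneg fun _ _ => by positivity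
  have htD : 0 < t / D := by positivity
  have arith : ∀ a : ℝ, min (c / 32) (7 / 144) ≤ a → 0 ≤ a → ∀ M N : ℝ, 0 ≤ M → M ≤ 2 * N →
      min (c / 32) (7 / 144) * (t / D) * M ≤ a * (t / D) * (2 * N) := by
    intro a ha ha₀ M N hM hN
    gcongr
  by_cases hcase : ∑ v, ((B v).card : ℝ) ≤ 2 * ∑ v, ((H v).card : ℝ)
  · obtain ⟨τ, hτ, h⟩ := ih.exists_signForm_le_of_many_triangles hk hc hG hD hs₁ hB hBG hHB
      fun v w hw => (not_le.mp (Finset.mem_filter.mp hw).2).le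
    refine ⟨τ, hτ, h.trans (neg_le_neg ?_)⟩
    rw [hsk]
    exact (arith _ (min_le_left _ _) (by positivity) _ _ hM hcase).trans_eq (by ring)
  · obtain ⟨τ, hτ, h⟩ := exists_signForm_le_of_few_triangles G hD hDs (B := L)
      (fun v => le_trans (by exact_mod_cast Finset.card_le_card (hLB v)) (hB v))
      (fun v u hu => hBG v u (hLB v hu)) fun u w hw => by
        refine le_trans ?_ (Finset.mem_filter.mp hw).2
        refine Nat.cast_le.mpr (Finset.card_le_card fun v hv => ?_)
        simp only [Finset.mem_filter, Finset.mem_univ, true_and] at hv ⊢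
        exact ⟨hv.1, hLB v hv.2⟩
    refine ⟨τ, hτ, h.trans (neg_le_neg ?_)⟩
    rw [hst]
    exact (arith _ (min_le_right _ _) (by positivity) _ (∑ v, ((L v).card : ℝ)) hM
      (by linarith)).trans_eq (by ring)

lemma exists_hasNegativeForm {k : ℕ} (hk : 1 ≤ k) : ∃ c, 0 < c ∧ HasNegativeForm k c := by
  induction k, hk using Nat.le_induction with
  | base => exact ⟨1, one_pos, hasNegativeForm_one⟩
  | succ k hk ih =>
    obtain ⟨c, hc, h⟩ := ih
    exact ⟨_, by positivity, h.succ hk hc⟩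

end InductiveStep

section Surplus

lemma Degenerate.exists_lists {V : Type*} [Fintype V] [DecidableEq V] {G : SimpleGraph V} {d : ℝ}
    (hd : 0 ≤ d) (hG : Degenerate G d) :
    ∃ B : V → Finset V, (∀ v, ((B v).card : ℝ) ≤ d) ∧ (∀ v, ∀ u ∈ B v, G.Adj v u) ∧
      ∀ u v, G.Adj u v → u ∈ B v ∨ v ∈ B u := by
  classical
  suffices h : ∀ S : Finset V, ∃ B : V → Finset V, (∀ v, ((B v).card : ℝ) ≤ d) ∧
      (∀ v, ∀ u ∈ B v, G.Adj v u) ∧ ∀ u ∈ S, ∀ v ∈ S, G.Adj u v → u ∈ B v ∨ v ∈ B u by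
    obtain ⟨B, h₁, h₂, h₃⟩ := h Finset.univ
    exact ⟨B, h₁, h₂, fun u v => h₃ u (Finset.mem_univ u) v (Finset.mem_univ v)⟩
  intro S
  induction S using Finset.strongInduction with
  | H S ih =>
    rcases S.eq_empty_or_nonempty with rfl | hS
    · exact ⟨fun _ => ∅, fun _ => by simpa using hd, by simp, by simp⟩
    · obtain ⟨x, hx, hdeg⟩ := hG S hS
      obtain ⟨B, h₁, h₂, h₃⟩ := ih _ (Finset.erase_ssubset hx)
      refine ⟨Function.update B x (S.filter (G.Adj x)), fun v => ?_, fun v u hu => ?_,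
        fun u hu v hv huv => ?_⟩
      · rcases eq_or_ne v x with rfl | hv
        · rw [Nat.card_eq_fintype_card, Fintype.card_subtype] at hdeg
          rw [Function.update_self]
          refine le_trans (le_of_eq ?_) hdeg
          congr 2
          ext u; simp
        · rw [Function.update_of_ne hv]; exact h₁ v
      · rcases eq_or_ne v x with rfl | hv
        · rw [Function.update_self] at hu
          exact (Finset.mem_filter.mp hu).2
        · rw [Function.update_of_ne hv] at hu; exact h₂ v u hu
      · rcases eq_or_ne u x with rfl | hux
        · right; simp [hv, huv]
        · rcases eq_or_ne v x with rfl | hvx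
          · left; simp [hu, huv.symm]
          · rw [Function.update_of_ne hux, Function.update_of_ne hvx]
            exact h₃ u (Finset.mem_erase.mpr ⟨hux, hu⟩) v (Finset.mem_erase.mpr ⟨hvx, hv⟩) huv

open scoped Classical in
lemma two_mul_edgeCount {V : Type*} [Fintype V] (G : SimpleGraph V) :
    2 * (edgeCount G : ℝ) = ∑ u, ∑ v, if G.Adj u v then (1 : ℝ) else 0 := by
  have h := G.sum_degrees_eq_twice_card_edges
  have he : edgeCount G = G.edgeFinset.card := by
    rw [edgeCount, Nat.card_eq_fintype_card, SimpleGraph.edgeFinset_card]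
  rw [he]
  have h' : (∑ v, (G.degree v : ℝ)) = 2 * (G.edgeFinset.card : ℝ) := by exact_mod_cast h
  rw [← h']
  refine Finset.sum_congr rfl fun u _ => ?_
  simp [← SimpleGraph.card_neighborFinset_eq_degree, SimpleGraph.neighborFinset_eq_filter]

lemma edgeCount_le_sum_card {V : Type*} [Fintype V] [DecidableEq V] (G : SimpleGraph V)
    {B : V → Finset V} (h : ∀ u v, G.Adj u v → u ∈ B v ∨ v ∈ B u) :
    (edgeCount G : ℝ) ≤ ∑ v, ((B v).card : ℝ) := by
  classical
  have hcard : ∀ v, ((B v).card : ℝ) = ∑ u, if u ∈ B v then (1 : ℝ) else 0 := fun v => by simp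
  have h₁ : ∑ u, ∑ v, (if G.Adj u v then (1 : ℝ) else 0) ≤
      ∑ u, ∑ v, ((if u ∈ B v then (1 : ℝ) else 0) + if v ∈ B u then (1 : ℝ) else 0) := by
    refine Finset.sum_le_sum fun u _ => Finset.sum_le_sum fun v _ => ?_
    by_cases hA : G.Adj u v
    · rcases h u v hA with h' | h' <;> simp only [hA, h', if_true] <;> split_ifs <;> norm_num
    · simp only [hA, if_false]; split_ifs <;> norm_num
  rw [← two_mul_edgeCount] at h₁
  simp only [Finset.sum_add_distrib] at h₁
  rw [Finset.sum_comm] at h₁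
  simp only [← hcard] at h₁
  linarith

lemma neg_signForm_div_four_le_surplus {V : Type*} [Fintype V] (G : SimpleGraph V)
    (σ : V → Bool) : -signForm G (fun v => boolSign (σ v)) / 4 ≤ surplus G := by
  classical
  set S : Finset V := Finset.univ.filter fun v => σ v = true with hS
  have hle : cutSize G S ≤ maxCut G :=
    Finset.le_sup (f := cutSize G) (Finset.mem_powerset.mpr (Finset.subset_univ S))
  have hle' : (cutSize G S : ℝ) ≤ maxCut G := by exact_mod_cast hle
  have hcut : (cutSize G S : ℝ) =
      ∑ u, ∑ v, if σ u = true ∧ σ v = false ∧ G.Adj u v then (1 : ℝ) else 0 := by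
    rw [cutSize, Nat.card_eq_fintype_card, Fintype.card_subtype, ← Fintype.sum_prod_type',
      Finset.card_filter]
    simp [hS]
  have hcut' : (cutSize G S : ℝ) =
      ∑ u, ∑ v, if σ v = true ∧ σ u = false ∧ G.Adj u v then (1 : ℝ) else 0 := by
    rw [hcut, Finset.sum_comm]
    simp only [G.adj_comm]
  have hform : signForm G (fun v => boolSign (σ v)) =
      2 * (edgeCount G : ℝ) - 2 * cutSize G S - 2 * cutSize G S := by
    rw [two_mul_edgeCount]
    nth_rewrite 1 [hcut]
    rw [hcut']
    simp only [signForm, Finset.mul_sum, ← Finset.sum_sub_distrib]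
    refine Finset.sum_congr rfl fun u _ => Finset.sum_congr rfl fun v _ => ?_
    by_cases hA : G.Adj u v <;> cases σ u <;> cases σ v <;> simp [hA, boolSign] <;> norm_num
  rw [hform, surplus]
  linarith

end Surplus

/-- For every `r ≥ 3` there is `c_r > 0` such that every `K_r`-free, `d`-degenerate
graph with `m` edges (`d ≥ 1`) has surplus at least `c_r · m / d^(1 - 1/(r-1))`. -/
theorem statement3 (r : ℕ) (hr : 3 ≤ r) :
    ∃ c : ℝ, 0 < c ∧
      ∀ (V : Type) [Fintype V] (G : SimpleGraph V) (d : ℝ),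
        1 ≤ d → G.CliqueFree r → Degenerate G d →
        surplus G ≥ c * edgeCount G / d ^ (1 - 1 / ((r : ℝ) - 1)) := by
  obtain ⟨k, rfl⟩ : ∃ k, r = k + 1 := ⟨r - 1, by omega⟩
  obtain ⟨c, hc, hk⟩ := exists_hasNegativeForm (k := k) (by omega)
  refine ⟨c / 4, by positivity, fun V _ G d hd hG hdeg => ?_⟩
  classical
  obtain ⟨B, hB, hBG, hcover⟩ := hdeg.exists_lists (by linarith)
  obtain ⟨τ, hτ, hform⟩ := hk V G hG B d hd hB hBG
  obtain ⟨σ, hσ⟩ := exists_boolSign_signForm_le G hτ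
  have hsurplus := neg_signForm_div_four_le_surplus G σ
  have hd₀ : 0 < d := by linarith
  have hpow : d ^ (1 - 1 / (((k + 1 : ℕ) : ℝ) - 1)) = d / d ^ (1 / (k : ℝ)) := by
    rw [Nat.cast_add_one, add_sub_cancel_right, Real.rpow_sub hd₀, Real.rpow_one]
  have hle : c * (d ^ (1 / (k : ℝ)) / d) * edgeCount G ≤
      c * (d ^ (1 / (k : ℝ)) / d) * ∑ v, ((B v).card : ℝ) := by
    gcongr
    exact edgeCount_le_sum_card G hcover
  have heq : c / 4 * edgeCount G / (d / d ^ (1 / (k : ℝ))) =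
      c * (d ^ (1 / (k : ℝ)) / d) * edgeCount G / 4 := by
    field_simp
  rw [hpow, heq]
  linarith

end MaxCutPaper
end

section
/- For every integer r ≥ 3 there exists a constant c_r > 0 such that every K_r-free finite simple graph with n ≥ 1 vertices and average degree d = 2e(G)/n has surplus at least c_r · d^(r−1) / n^(r−3). -/
namespace MaxCutPaper

variable {V : Type*}

section GaussianRounding

open MeasureTheory ProbabilityTheory

/-- The characteristic function of a standard Gaussian vector, in its cosine form. -/
lemma integral_cos_gaussian {ι : Type*} [Fintype ι] (t : ι → ℝ) :
    ∫ g : ι → ℝ, Real.cos (∑ i, t i * g i) ∂(Measure.pi fun _ ↦ gaussianReal 0 1) =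
      Real.exp (-(∑ i, t i ^ 2) / 2) := by
  have hprod := integral_fintype_prod_eq_prod (𝕜 := ℂ)
    (fun (i : ι) (y : ℝ) ↦ Complex.exp (t i * y * Complex.I))
    (μ := fun _ ↦ gaussianReal 0 1)
  have hfactor (i : ι) : ∫ y : ℝ, Complex.exp (t i * y * Complex.I) ∂(gaussianReal 0 1) =
      Complex.exp (-(t i : ℂ) ^ 2 / 2) := by
    rw [← charFun_apply_real, charFun_gaussianReal]
    congr 1
    simp
    ring
  simp_rw [hfactor, ← Complex.exp_sum] at hprod
  have hint : Integrable (fun g : ι → ℝ ↦ Complex.exp (∑ i, t i * g i * Complex.I))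
      (Measure.pi fun _ ↦ gaussianReal 0 1) := by
    refine Integrable.of_bound (C := 1) (Continuous.aestronglyMeasurable (by fun_prop)) (Filter.Eventually.of_forall fun g ↦ ?_)
    rw [← Finset.sum_mul]
    have := Complex.norm_exp_ofReal_mul_I (∑ i, t i * g i)
    push_cast at this
    exact this.le
  have hre := congrArg Complex.re hprod
  rw [← Complex.reCLM_apply, ← Complex.reCLM.integral_comp_comm hint] at hre
  have hcos (g : ι → ℝ) : Complex.reCLM (Complex.exp (∑ i, t i * g i * Complex.I)) =
      Real.cos (∑ i, t i * g i) := by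
    rw [← Finset.sum_mul, Complex.reCLM_apply, ← Complex.exp_ofReal_mul_I_re]
    push_cast
    rfl
  simp_rw [hcos] at hre
  rw [hre, ← Complex.exp_ofReal_re]
  congr 2
  push_cast
  rw [← Finset.sum_div, Finset.sum_neg_distrib]

lemma integral_sin_mul_sin_gaussian {ι : Type*} [Fintype ι] (x y : ι → ℝ) :
    ∫ g : ι → ℝ, Real.sin (∑ i, x i * g i) * Real.sin (∑ i, y i * g i)
        ∂(Measure.pi fun _ ↦ gaussianReal 0 1) =
      Real.exp (-(∑ i, x i ^ 2 + ∑ i, y i ^ 2) / 2) * Real.sinh (∑ i, x i * y i) := by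
  have hcos (t : ι → ℝ) : Integrable (fun g : ι → ℝ ↦ Real.cos (∑ i, t i * g i))
      (Measure.pi fun _ ↦ gaussianReal 0 1) :=
    Integrable.of_bound (C := 1) (Continuous.aestronglyMeasurable (by fun_prop))
      (Filter.Eventually.of_forall fun g ↦ Real.abs_cos_le_one _)
  have hpt (g : ι → ℝ) : Real.sin (∑ i, x i * g i) * Real.sin (∑ i, y i * g i) =
      1 / 2 * (Real.cos (∑ i, (x i - y i) * g i) - Real.cos (∑ i, (x i + y i) * g i)) := by
    simp_rw [sub_mul, add_mul, Finset.sum_sub_distrib, Finset.sum_add_distrib,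
      Real.cos_sub, Real.cos_add]
    ring
  simp_rw [hpt]
  rw [integral_const_mul, integral_sub (hcos _) (hcos _), integral_cos_gaussian,
    integral_cos_gaussian, Real.sinh_eq]
  have h1 : -(∑ i, (x i - y i) ^ 2) / 2 =
      -(∑ i, x i ^ 2 + ∑ i, y i ^ 2) / 2 + ∑ i, x i * y i := by
    simp_rw [sub_sq, Finset.sum_add_distrib, Finset.sum_sub_distrib, mul_assoc,
      ← Finset.mul_sum]
    ring
  have h2 : -(∑ i, (x i + y i) ^ 2) / 2 =
      -(∑ i, x i ^ 2 + ∑ i, y i ^ 2) / 2 + -∑ i, x i * y i := by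
    simp_rw [add_sq, Finset.sum_add_distrib, mul_assoc, ← Finset.mul_sum]
    ring
  rw [h1, h2, Real.exp_add, Real.exp_add]
  ring

/-- Rounding of vectors to numbers in `[-1, 1]` by taking the sine of a random Gaussian
projection. -/
lemma exists_sin_rounding {V ι : Type*} [Fintype ι] (S : Finset V) (M : V → V → ℝ)
    (x : V → ι → ℝ) :
    ∃ f : V → ℝ, (∀ v, |f v| ≤ 1) ∧
      ∑ u ∈ S, ∑ v ∈ S, M u v * (f u * f v) ≤
        ∑ u ∈ S, ∑ v ∈ S, M u v * (Real.exp (-(∑ i, x u i ^ 2 + ∑ i, x v i ^ 2) / 2) *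
          Real.sinh (∑ i, x u i * x v i)) := by
  set f : (ι → ℝ) → V → ℝ := fun g v ↦ Real.sin (∑ i, x v i * g i) with hf
  have hint (u v : V) : Integrable (fun g : ι → ℝ ↦ M u v * (f g u * f g v))
      (Measure.pi fun _ ↦ gaussianReal 0 1) := by
    refine Integrable.const_mul (Integrable.of_bound (C := 1) (Continuous.aestronglyMeasurable (by simp only [hf]; fun_prop))
      (Filter.Eventually.of_forall fun g ↦ ?_)) _
    rw [Real.norm_eq_abs, abs_mul]
    exact mul_le_one₀ (Real.abs_sin_le_one _) (abs_nonneg _) (Real.abs_sin_le_one _)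
  obtain ⟨g, hg⟩ := exists_le_integral (integrable_finsetSum S fun u _ ↦
    integrable_finsetSum S fun v _ ↦ hint u v)
  refine ⟨f g, fun v ↦ Real.abs_sin_le_one _, ?_⟩
  rw [integral_finsetSum _ fun u _ ↦ integrable_finsetSum S fun v _ ↦ hint u v] at hg
  simp_rw [integral_finsetSum _ fun v _ ↦ hint _ v, integral_const_mul] at hg
  simpa only [hf, integral_sin_mul_sin_gaussian] using hg

lemma exp_mul_sinh_le {s p b : ℝ} (hs : s ≤ 1) (hs0 : 0 ≤ s) (hp : 0 ≤ p) (hb : 0 ≤ b)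
    (hpb : |p - b| ≤ 1) : Real.exp (-s) * Real.sinh (p - b) ≤ 2 * p - b / 3 := by
  have hexp1 : Real.exp (-s) ≤ 1 := Real.exp_le_one_iff.2 (by linarith)
  have hexp3 : 1 / 3 ≤ Real.exp (-s) := by
    have h1 : Real.exp (-1) ≤ Real.exp (-s) := Real.exp_le_exp.2 (by linarith)
    have h2 : 1 / 3 ≤ Real.exp (-1) := by
      rw [Real.exp_neg, ← one_div]
      exact one_div_le_one_div_of_le (Real.exp_pos 1) (by linarith [Real.exp_one_lt_d9])
    linarith
  rcases le_total 0 (p - b) with h | h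
  · have h1 := (abs_le.1 (Real.abs_exp_sub_one_sub_id_le hpb)).2
    have h2 := Real.add_one_le_exp (-(p - b))
    have h3 : p - b ≤ 1 := (abs_le.1 hpb).2
    have hsinh : Real.sinh (p - b) ≤ 3 / 2 * (p - b) := by
      rw [Real.sinh_eq]
      nlinarith
    have h4 : 0 ≤ Real.sinh (p - b) := Real.sinh_nonneg_iff.2 h
    nlinarith
  · have hsinh : Real.sinh (p - b) ≤ p - b := Real.sinh_le_self_iff.2 h
    nlinarith

end GaussianRounding

section Gain

/-- The total weight of ordered pairs inside `S`. -/
def weightIn (a : V → V → ℝ) (S : Finset V) : ℝ := ∑ u ∈ S, ∑ v ∈ S, a u v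

/-- The total weight of ordered triangles with two vertices in `R` and the third in `B`. -/
def triWeight (a : V → V → ℝ) (B R : Finset V) : ℝ :=
  ∑ u ∈ R, ∑ v ∈ R, a u v * ∑ w ∈ B, a u w * a v w

/-- Some assignment of numbers in `[-1, 1]` makes the quadratic form of `a` on `S` at most `-t`.
For the adjacency matrix of a graph this means that the surplus on `S` is at least `t / 4`. -/
def HasGain (a : V → V → ℝ) (S : Finset V) (t : ℝ) : Prop :=
  ∃ f : V → ℝ, (∀ v, |f v| ≤ 1) ∧ ∑ u ∈ S, ∑ v ∈ S, a u v * (f u * f v) ≤ -t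

variable {a : V → V → ℝ} {S T : Finset V} {s t : ℝ}

lemma HasGain.mono (h : HasGain a S t) (hst : s ≤ t) : HasGain a S s := by
  obtain ⟨f, hf, h⟩ := h
  exact ⟨f, hf, h.trans (neg_le_neg hst)⟩

lemma hasGain_of_nonpos (ht : t ≤ 0) : HasGain a S t :=
  ⟨fun _ ↦ 0, by simp, by simpa using ht⟩

open Classical in
lemma HasGain.subset (h : HasGain a S t) (hST : S ⊆ T) : HasGain a T t := by
  obtain ⟨f, hf, h⟩ := h
  refine ⟨fun v ↦ if v ∈ S then f v else 0, fun v ↦ ?_, ?_⟩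
  · dsimp only
    split_ifs
    · exact hf v
    · simp
  · refine le_of_eq_of_le ?_ h
    symm
    have (u : V) : ∑ v ∈ T, a u v *
        ((if u ∈ S then f u else 0) * (if v ∈ S then f v else 0)) =
        if u ∈ S then ∑ v ∈ S, a u v * (f u * f v) else 0 := by
      split_ifs with hu
      · rw [← Finset.sum_subset hST fun v _ hv ↦ by simp [hv]]
        exact Finset.sum_congr rfl fun v hv ↦ by simp [hv]
      · simp
    simp_rw [this]
    rw [← Finset.sum_subset hST fun u _ hu ↦ by simp [hu]]
    exact Finset.sum_congr rfl fun u hu ↦ by simp [hu]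

variable [DecidableEq V]

lemma sum_sum_union_of_symm {b : V → V → ℝ} (hb : ∀ u v, b u v = b v u) (hST : Disjoint S T) :
    ∑ u ∈ S ∪ T, ∑ v ∈ S ∪ T, b u v =
      ∑ u ∈ S, ∑ v ∈ S, b u v + ∑ u ∈ T, ∑ v ∈ T, b u v + 2 * ∑ u ∈ S, ∑ v ∈ T, b u v := by
  have hcomm : ∑ u ∈ T, ∑ v ∈ S, b u v = ∑ u ∈ S, ∑ v ∈ T, b u v := by
    rw [Finset.sum_comm]
    exact Finset.sum_congr rfl fun u _ ↦ Finset.sum_congr rfl fun v _ ↦ hb v u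
  simp_rw [Finset.sum_union hST, Finset.sum_add_distrib]
  rw [hcomm]
  ring

lemma HasGain.union (ha : ∀ u v, a u v = a v u) (hST : Disjoint S T)
    (hS : HasGain a S s) (hT : HasGain a T t) : HasGain a (S ∪ T) (s + t) := by
  obtain ⟨f, hf, hfs⟩ := hS
  obtain ⟨g, hg, hgt⟩ := hT
  suffices H : ∃ e : ℝ, |e| = 1 ∧ e * ∑ u ∈ S, ∑ v ∈ T, a u v * (f u * g v) ≤ 0 by
    obtain ⟨e, he, hneg⟩ := H
    have hTS {v : V} (hv : v ∈ T) : v ∉ S := Finset.disjoint_right.1 hST hv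
    refine ⟨fun v ↦ if v ∈ S then f v else e * g v, fun v ↦ ?_, ?_⟩
    · dsimp only
      split_ifs
      · exact hf v
      · rw [abs_mul, he, one_mul]
        exact hg v
    · rw [sum_sum_union_of_symm (fun u v ↦ by rw [ha u v]; ring) hST]
      have h1 : ∑ u ∈ S, ∑ v ∈ S, a u v * ((if u ∈ S then f u else e * g u) *
          (if v ∈ S then f v else e * g v)) = ∑ u ∈ S, ∑ v ∈ S, a u v * (f u * f v) :=
        Finset.sum_congr rfl fun u hu ↦ Finset.sum_congr rfl fun v hv ↦ by simp [hu, hv]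
      have h2 : ∑ u ∈ T, ∑ v ∈ T, a u v * ((if u ∈ S then f u else e * g u) *
          (if v ∈ S then f v else e * g v)) = ∑ u ∈ T, ∑ v ∈ T, a u v * (g u * g v) := by
        refine Finset.sum_congr rfl fun u hu ↦ Finset.sum_congr rfl fun v hv ↦ ?_
        have : e * e = 1 := by rw [← abs_mul_abs_self, he, one_mul]
        simp only [hTS hu, hTS hv, if_false]
        linear_combination (a u v * (g u * g v)) * this
      have h3 : ∑ u ∈ S, ∑ v ∈ T, a u v * ((if u ∈ S then f u else e * g u) *
          (if v ∈ S then f v else e * g v)) = e * ∑ u ∈ S, ∑ v ∈ T, a u v * (f u * g v) := by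
        simp_rw [Finset.mul_sum]
        refine Finset.sum_congr rfl fun u hu ↦ Finset.sum_congr rfl fun v hv ↦ ?_
        simp only [hu, hTS hv, if_true, if_false]
        ring
      rw [h1, h2, h3]
      linarith
  rcases le_total (∑ u ∈ S, ∑ v ∈ T, a u v * (f u * g v)) 0 with h | h
  · exact ⟨1, by simp, by linarith⟩
  · exact ⟨-1, by simp, by linarith⟩

lemma hasGain_cut (ha : ∀ u v, a u v = a v u) (hST : Disjoint S T) :
    HasGain a (S ∪ T) (2 * ∑ u ∈ S, ∑ v ∈ T, a u v - weightIn a S - weightIn a T) := by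
  have hTS {v : V} (hv : v ∈ T) : v ∉ S := Finset.disjoint_right.1 hST hv
  refine ⟨fun v ↦ if v ∈ S then 1 else -1, fun v ↦ ?_, ?_⟩
  · dsimp only
    split_ifs <;> simp
  · rw [sum_sum_union_of_symm (fun u v ↦ by rw [ha u v]; ring) hST]
    refine le_of_eq ?_
    have h1 : ∑ u ∈ S, ∑ v ∈ S, a u v * ((if u ∈ S then (1 : ℝ) else -1) *
        (if v ∈ S then 1 else -1)) = weightIn a S :=
      Finset.sum_congr rfl fun u hu ↦ Finset.sum_congr rfl fun v hv ↦ by simp [hu, hv]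
    have h2 : ∑ u ∈ T, ∑ v ∈ T, a u v * ((if u ∈ S then (1 : ℝ) else -1) *
        (if v ∈ S then 1 else -1)) = weightIn a T :=
      Finset.sum_congr rfl fun u hu ↦ Finset.sum_congr rfl fun v hv ↦ by simp [hTS hu, hTS hv]
    have h3 : ∑ u ∈ S, ∑ v ∈ T, a u v * ((if u ∈ S then (1 : ℝ) else -1) *
        (if v ∈ S then 1 else -1)) = -∑ u ∈ S, ∑ v ∈ T, a u v := by
      simp_rw [← Finset.sum_neg_distrib]
      exact Finset.sum_congr rfl fun u hu ↦ Finset.sum_congr rfl fun v hv ↦ by simp [hu, hTS hv]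
    rw [h1, h2, h3]
    ring

end Gain

section FewTriangles

variable {a : V → V → ℝ} {B : Finset V}

/-- Rounding the vectors `u ↦ 1_{N(u)} - κ` inside `B`, scaled by `√s`. -/
lemma hasGain_of_neighborhood_vectors (ha : ∀ u v, a u v = a v u)
    (ha01 : ∀ u v, a u v = 0 ∨ a u v = 1) {κ s : ℝ} (hκ : 0 ≤ κ) (hs : 0 ≤ s)
    (hdeg : ∀ u ∈ B, s * (∑ w ∈ B, a u w + κ ^ 2 * B.card) ≤ 1) :
    HasGain a B (s * (2 / 3 * κ * ∑ u ∈ B, (∑ w ∈ B, a u w) ^ 2 - 2 * triWeight a B B -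
      2 * κ ^ 2 * B.card * weightIn a B)) := by
  have ha0 (u v : V) : 0 ≤ a u v := by rcases ha01 u v with h | h <;> simp [h]
  have hsq (u v : V) : a u v ^ 2 = a u v := by rcases ha01 u v with h | h <;> simp [h]
  set x : V → B → ℝ := fun u w ↦ √s * (a u w - κ) with hx
  obtain ⟨f, hf, hle⟩ := exists_sin_rounding B a x
  refine ⟨f, hf, hle.trans ?_⟩
  have hinner (u v : V) : ∑ i, x u i * x v i = s * (∑ w ∈ B, a u w * a v w + κ ^ 2 * B.card) -
      s * (κ * (∑ w ∈ B, a u w + ∑ w ∈ B, a v w)) := by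
    simp only [hx]
    rw [Finset.sum_coe_sort B (fun w ↦ √s * (a u w - κ) * (√s * (a v w - κ)))]
    have (w : V) : √s * (a u w - κ) * (√s * (a v w - κ)) =
        s * (a u w * a v w) + s * κ ^ 2 - s * κ * a u w - s * κ * a v w := by
      linear_combination ((a u w - κ) * (a v w - κ)) * Real.mul_self_sqrt hs
    simp_rw [this, Finset.sum_sub_distrib, Finset.sum_add_distrib, ← Finset.mul_sum,
      Finset.sum_const, nsmul_eq_mul]
    ring
  have hnorm (u : V) (hu : u ∈ B) : ∑ i, x u i ^ 2 ≤ 1 := by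
    have h1 : ∑ i, x u i ^ 2 = ∑ i, x u i * x u i := Finset.sum_congr rfl fun i _ ↦ sq _
    have h2 : 0 ≤ s * (κ * (∑ w ∈ B, a u w + ∑ w ∈ B, a u w)) :=
      mul_nonneg hs (mul_nonneg hκ (add_nonneg (Finset.sum_nonneg fun w _ ↦ ha0 u w)
        (Finset.sum_nonneg fun w _ ↦ ha0 u w)))
    have h3 : ∑ w ∈ B, a u w * a u w = ∑ w ∈ B, a u w :=
      Finset.sum_congr rfl fun w _ ↦ by rw [← sq, hsq]
    rw [h1, hinner, h3]
    linarith [hdeg u hu]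
  have habs (u v : V) (hu : u ∈ B) (hv : v ∈ B) : |∑ i, x u i * x v i| ≤ 1 := by
    have h1 : |∑ i, x u i * x v i| ≤ ∑ i, (x u i ^ 2 + x v i ^ 2) / 2 := by
      refine (Finset.abs_sum_le_sum_abs _ _).trans (Finset.sum_le_sum fun i _ ↦ ?_)
      rw [abs_le]
      constructor <;> nlinarith [sq_nonneg (x u i + x v i), sq_nonneg (x u i - x v i)]
    rw [← Finset.sum_div, Finset.sum_add_distrib] at h1
    linarith [hnorm u hu, hnorm v hv]
  calc _ ≤ ∑ u ∈ B, ∑ v ∈ B, a u v *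
        (2 * (s * (∑ w ∈ B, a u w * a v w + κ ^ 2 * B.card)) -
          s * (κ * (∑ w ∈ B, a u w + ∑ w ∈ B, a v w)) / 3) := by
        refine Finset.sum_le_sum fun u hu ↦ Finset.sum_le_sum fun v hv ↦
          mul_le_mul_of_nonneg_left ?_ (ha0 u v)
        have habs' := habs u v hu hv
        rw [hinner] at habs' ⊢
        rw [neg_div]
        refine exp_mul_sinh_le ?_ ?_ ?_ ?_ habs'
        · linarith [hnorm u hu, hnorm v hv]
        · positivity
        · exact mul_nonneg hs (add_nonneg (Finset.sum_nonneg fun w _ ↦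
            mul_nonneg (ha0 u w) (ha0 v w)) (by positivity))
        · exact mul_nonneg hs (mul_nonneg hκ (add_nonneg (Finset.sum_nonneg fun w _ ↦ ha0 u w)
            (Finset.sum_nonneg fun w _ ↦ ha0 v w)))
    _ = _ := by
        have hdeg1 : ∑ u ∈ B, ∑ v ∈ B, a u v * ∑ w ∈ B, a u w =
            ∑ u ∈ B, (∑ w ∈ B, a u w) ^ 2 := by
          simp_rw [← Finset.sum_mul, sq]
        have hdeg2 : ∑ u ∈ B, ∑ v ∈ B, a u v * ∑ w ∈ B, a v w =
            ∑ u ∈ B, (∑ w ∈ B, a u w) ^ 2 := by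
          rw [Finset.sum_comm, ← hdeg1]
          exact Finset.sum_congr rfl fun u _ ↦ Finset.sum_congr rfl fun v _ ↦ by rw [ha]
        have hexpand (u v : V) : a u v *
            (2 * (s * (∑ w ∈ B, a u w * a v w + κ ^ 2 * B.card)) -
              s * (κ * (∑ w ∈ B, a u w + ∑ w ∈ B, a v w)) / 3) =
            2 * s * (a u v * ∑ w ∈ B, a u w * a v w) + 2 * s * κ ^ 2 * B.card * a u v -
              s * κ / 3 * (a u v * ∑ w ∈ B, a u w) - s * κ / 3 * (a u v * ∑ w ∈ B, a v w) := by
          ring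
        simp_rw [hexpand, Finset.sum_sub_distrib, Finset.sum_add_distrib, ← Finset.mul_sum]
        rw [hdeg1, hdeg2, triWeight, weightIn]
        ring

/-- If the degrees are at most a constant times the average degree `d` and there are only few
triangles, the gain is of order `d ^ 2`. -/
lemma hasGain_of_few_triangles (ha : ∀ u v, a u v = a v u)
    (ha01 : ∀ u v, a u v = 0 ∨ a u v = 1) {d n : ℝ} (hd : 0 < d) (hdn : d ≤ n)
    (hBn : (B.card : ℝ) ≤ n) (hdeg : ∀ u ∈ B, ∑ w ∈ B, a u w ≤ 10 * d)
    (hlow : 3 / 10 * (d * n) ≤ weightIn a B) (hT : triWeight a B B ≤ d ^ 3 / 2000) :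
    HasGain a B (d ^ 2 / 25000) := by
  have hn : 0 < n := hd.trans_le hdn
  have hB0 : (0 : ℝ) ≤ B.card := by positivity
  set F := weightIn a B with hF
  set Q := ∑ u ∈ B, (∑ w ∈ B, a u w) ^ 2 with hQ
  have hQ0 : 0 ≤ Q := Finset.sum_nonneg fun u _ ↦ sq_nonneg _
  have hCS : F ^ 2 ≤ n * Q :=
    (sq_sum_le_card_mul_sum_sq (s := B) (f := fun u ↦ ∑ w ∈ B, a u w)).trans
      (mul_le_mul_of_nonneg_right hBn hQ0)
  have hF0 : 0 ≤ F := le_trans (by positivity) hlow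
  have hκ1 : (d / (20 * n)) ^ 2 * B.card ≤ d ^ 2 / (400 * n) := by
    rw [div_pow, div_mul_eq_mul_div, div_le_div_iff₀ (by positivity) (by positivity)]
    nlinarith [mul_le_mul_of_nonneg_left hBn (by positivity : 0 ≤ d ^ 2 * n)]
  have hκ2 : d ^ 2 / (400 * n) ≤ d := by
    rw [div_le_iff₀ (by positivity)]
    nlinarith [mul_le_mul_of_nonneg_left hdn hd.le]
  refine (hasGain_of_neighborhood_vectors ha ha01 (κ := d / (20 * n)) (s := 1 / (11 * d))
    (by positivity) (by positivity) fun u hu ↦ ?_).mono ?_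
  · rw [div_mul_eq_mul_div, div_le_one (by positivity)]
    linarith [hdeg u hu]
  · have h1 : 2 * (d / (20 * n)) ^ 2 * B.card * F ≤ d ^ 2 / (200 * n) * F := by
      refine mul_le_mul_of_nonneg_right ?_ hF0
      have : d ^ 2 / (200 * n) = 2 * (d ^ 2 / (400 * n)) := by
        field_simp
        norm_num
      linarith
    have h2 : 2 / 3 * (d / (20 * n)) * (F ^ 2 / n) ≤ 2 / 3 * (d / (20 * n)) * Q := by
      refine mul_le_mul_of_nonneg_left ?_ (by positivity)
      rw [div_le_iff₀ hn]
      linarith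
    have h3 : d ^ 3 * (3 / 2000) ≤ 2 / 3 * (d / (20 * n)) * (F ^ 2 / n) -
        d ^ 2 / (200 * n) * F := by
      have h4 : 2 / 3 * (d / (20 * n)) * (F ^ 2 / n) - d ^ 2 / (200 * n) * F =
          d * F / (30 * n ^ 2) * (F - 3 / 20 * (d * n)) := by
        field_simp
        ring
      rw [h4, div_mul_eq_mul_div, le_div_iff₀ (by positivity)]
      have h5 : (3 / 10 * (d * n)) * (3 / 20 * (d * n)) ≤ F * (F - 3 / 20 * (d * n)) :=
        mul_le_mul hlow (by linarith) (by positivity) hF0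
      nlinarith [mul_le_mul_of_nonneg_left h5 hd.le]
    have h6 : d ^ 2 / 25000 ≤ 1 / (11 * d) * (d ^ 3 / 2000) := by
      rw [div_mul_div_comm, div_le_div_iff₀ (by positivity) (by positivity)]
      nlinarith [pow_pos hd 3]
    refine h6.trans (mul_le_mul_of_nonneg_left ?_ (by positivity))
    linarith

end FewTriangles

section Greedy

lemma sum_filter_eq_one {h g : V → ℝ} (hh : ∀ v, h v = 0 ∨ h v = 1) (R : Finset V) :
    ∑ v ∈ R with h v = 1, g v = ∑ v ∈ R, h v * g v := by
  rw [Finset.sum_filter]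
  exact Finset.sum_congr rfl fun v _ ↦ by rcases hh v with h | h <;> simp [h]

lemma sum_filter_ne_one {h g : V → ℝ} (hh : ∀ v, h v = 0 ∨ h v = 1) (R : Finset V) :
    ∑ v ∈ R with h v ≠ 1, g v = ∑ v ∈ R, (1 - h v) * g v := by
  rw [Finset.sum_filter]
  exact Finset.sum_congr rfl fun v _ ↦ by rcases hh v with h | h <;> simp [h]

variable {a : V → V → ℝ} {B : Finset V}

/-- A neighbourhood whose removal from `R` destroys few triangles compared to the number of edges
it contains. -/
lemma exists_good_neighborhood (ha : ∀ u v, a u v = a v u)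
    (ha01 : ∀ u v, a u v = 0 ∨ a u v = 1) {D : ℝ}
    (hdeg : ∀ u ∈ B, ∑ w ∈ B, a u w ≤ D) {R : Finset V} (hR : R ⊆ B)
    (hpos : 0 < triWeight a B R) :
    ∃ w ∈ B, (R.filter fun v ↦ a w v = 1).Nonempty ∧
      triWeight a B R - triWeight a B (R.filter fun v ↦ a w v ≠ 1) ≤
        2 * D * weightIn a (R.filter fun v ↦ a w v = 1) := by
  have ha0 (u v : V) : 0 ≤ a u v := by rcases ha01 u v with h | h <;> simp [h]
  have ha1 (u v : V) : a u v ≤ 1 := by rcases ha01 u v with h | h <;> simp [h]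
  set b : V → V → ℝ := fun u v ↦ a u v * ∑ w ∈ B, a u w * a v w with hb
  have hb0 (u v : V) : 0 ≤ b u v :=
    mul_nonneg (ha0 u v) (Finset.sum_nonneg fun w _ ↦ mul_nonneg (ha0 u w) (ha0 v w))
  have hbsymm (u v : V) : b u v = b v u := by
    simp only [hb]
    rw [ha u v]
    exact congrArg _ (Finset.sum_congr rfl fun w _ ↦ mul_comm _ _)
  have htri (R : Finset V) : triWeight a B R = ∑ u ∈ R, ∑ v ∈ R, b u v := rfl
  have hwt : ∑ w ∈ B, weightIn a (R.filter fun v ↦ a w v = 1) = triWeight a B R := by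
    have (w : V) : weightIn a (R.filter fun v ↦ a w v = 1) =
        ∑ u ∈ R, ∑ v ∈ R, a u v * (a u w * a v w) := by
      rw [weightIn, sum_filter_eq_one (ha01 w)]
      refine Finset.sum_congr rfl fun u _ ↦ ?_
      rw [sum_filter_eq_one (ha01 w), Finset.mul_sum]
      exact Finset.sum_congr rfl fun v _ ↦ by rw [ha w u, ha w v]; ring
    simp_rw [this]
    rw [Finset.sum_comm, triWeight]
    refine Finset.sum_congr rfl fun u _ ↦ ?_
    rw [Finset.sum_comm]
    exact Finset.sum_congr rfl fun v _ ↦ by rw [Finset.mul_sum]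
  have hloss (w : V) : triWeight a B R - triWeight a B (R.filter fun v ↦ a w v ≠ 1) ≤
      ∑ u ∈ R, ∑ v ∈ R, b u v * (a u w + a v w) := by
    rw [htri, htri, sum_filter_ne_one (ha01 w), ← Finset.sum_sub_distrib]
    refine Finset.sum_le_sum fun u _ ↦ ?_
    rw [sum_filter_ne_one (ha01 w), Finset.mul_sum, ← Finset.sum_sub_distrib]
    refine Finset.sum_le_sum fun v _ ↦ ?_
    rw [ha u w, ha v w]
    nlinarith [mul_nonneg (hb0 u v) (mul_nonneg (ha0 w u) (ha0 w v))]
  have hsum : ∑ w ∈ B, ∑ u ∈ R, ∑ v ∈ R, b u v * (a u w + a v w) ≤ 2 * D * triWeight a B R := by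
    rw [Finset.sum_comm, htri, Finset.mul_sum]
    refine Finset.sum_le_sum fun u hu ↦ ?_
    rw [Finset.sum_comm, Finset.mul_sum]
    refine Finset.sum_le_sum fun v hv ↦ ?_
    rw [← Finset.mul_sum, Finset.sum_add_distrib]
    nlinarith [hdeg u (hR hu), hdeg v (hR hv), hb0 u v]
  by_contra! hcon
  obtain ⟨w₀, hw₀, hw₀pos⟩ : ∃ w ∈ B, 0 < weightIn a (R.filter fun v ↦ a w v = 1) := by
    by_contra! h
    linarith [Finset.sum_nonpos h]
  have hne₀ : (R.filter fun v ↦ a w₀ v = 1).Nonempty := by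
    rw [Finset.nonempty_iff_ne_empty]
    intro h
    simp [h, weightIn] at hw₀pos
  have hlt : ∑ w ∈ B, 2 * D * weightIn a (R.filter fun v ↦ a w v = 1) <
      ∑ w ∈ B, (triWeight a B R - triWeight a B (R.filter fun v ↦ a w v ≠ 1)) := by
    refine Finset.sum_lt_sum (fun w hw ↦ ?_) ⟨w₀, hw₀, hcon w₀ hw₀ hne₀⟩
    rcases Finset.eq_empty_or_nonempty (R.filter fun v ↦ a w v = 1) with h | h
    · have h' : (R.filter fun v ↦ a w v ≠ 1) = R := by
        rw [Finset.filter_eq_self]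
        exact fun v hv ↦ Finset.filter_eq_empty_iff.1 h hv
      rw [h, h']
      simp [weightIn]
    · exact (hcon w hw h).le
  rw [← Finset.mul_sum, hwt] at hlt
  linarith [Finset.sum_le_sum fun w (_ : w ∈ B) ↦ hloss w]

lemma pow_mul_sub_le_pow_succ {x y : ℝ} (hx : 0 ≤ x) (hy : 0 ≤ y) (k : ℕ) :
    y ^ k * (x - y) ≤ x ^ (k + 1) := by
  rcases le_total y x with h | h
  · rw [pow_succ]
    exact mul_le_mul (pow_le_pow_left₀ hy h k) (by linarith) (by linarith) (by positivity)
  · exact (mul_nonpos_of_nonneg_of_nonpos (by positivity) (by linarith)).trans (by positivity)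

variable [DecidableEq V]

/-- Gains inside neighbourhoods combine: greedily partition `R` into parts of neighbourhoods. -/
lemma hasGain_of_hasGain_neighborhoods (ha : ∀ u v, a u v = a v u)
    (ha01 : ∀ u v, a u v = 0 ∨ a u v = 1) {D c y : ℝ} (hD : 0 < D) (hc : 0 ≤ c) (hy : 0 ≤ y)
    (k : ℕ) (hdeg : ∀ u ∈ B, ∑ w ∈ B, a u w ≤ D)
    (hpiece : ∀ w ∈ B, ∀ P ⊆ B, (∀ v ∈ P, a w v = 1) →
      HasGain a P (c * (P.card : ℝ) ^ 2 * (weightIn a P / (P.card : ℝ) ^ 2) ^ (k + 1)))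
    (R : Finset V) (hR : R ⊆ B) :
    HasGain a R (c * y ^ k * (triWeight a B R / (2 * D) - y * D * R.card)) := by
  have ha0 (u v : V) : 0 ≤ a u v := by rcases ha01 u v with h | h <;> simp [h]
  induction R using Finset.strongInduction with
  | H R ih =>
    rcases le_or_gt (triWeight a B R) 0 with hT | hT
    · refine hasGain_of_nonpos (mul_nonpos_of_nonneg_of_nonpos (by positivity) ?_)
      have h1 : triWeight a B R / (2 * D) ≤ 0 := div_nonpos_of_nonpos_of_nonneg hT (by positivity)
      have h2 : 0 ≤ y * D * R.card := by positivity
      linarith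
    · obtain ⟨w, hw, hne, hle⟩ := exists_good_neighborhood ha ha01 hdeg hR hT
      set P := R.filter fun v ↦ a w v = 1 with hP
      set Q := R.filter fun v ↦ a w v ≠ 1 with hQ
      have hdisj : Disjoint P Q := Finset.disjoint_filter_filter_not _ _ _
      have hunion : P ∪ Q = R := Finset.filter_union_filter_not_eq _ _
      have hQR : Q ⊂ R := by
        obtain ⟨v, hv⟩ := hne
        refine (Finset.ssubset_iff_of_subset (Finset.filter_subset _ _)).2
          ⟨v, Finset.mem_of_mem_filter v hv, Finset.disjoint_left.1 hdisj hv⟩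
      have hPB : P ⊆ B := (Finset.filter_subset _ _).trans hR
      have hP1 (v : V) (hv : v ∈ P) : a w v = 1 := (Finset.mem_filter.1 hv).2
      have hcard : (R.card : ℝ) = P.card + Q.card := by
        rw [← hunion, Finset.card_union_of_disjoint hdisj]
        push_cast
        rfl
      have hPD : (P.card : ℝ) ≤ D := by
        calc (P.card : ℝ) = ∑ v ∈ P, a w v := by
              rw [Finset.sum_congr rfl hP1]
              simp
          _ ≤ ∑ v ∈ B, a w v := Finset.sum_le_sum_of_subset_of_nonneg hPB fun v _ _ ↦ ha0 w v
          _ ≤ D := hdeg w hw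
      have hPpos : (0 : ℝ) < P.card := by exact_mod_cast hne.card_pos
      have hwt0 : 0 ≤ weightIn a P :=
        Finset.sum_nonneg fun u _ ↦ Finset.sum_nonneg fun v _ ↦ ha0 u v
      have hgain := (hpiece w hw P hPB hP1).union ha hdisj (ih Q hQR (hQR.subset.trans hR))
      rw [hunion] at hgain
      refine hgain.mono ?_
      have h1 : y ^ k * (weightIn a P - y * D * P.card) ≤
          (P.card : ℝ) ^ 2 * (weightIn a P / (P.card : ℝ) ^ 2) ^ (k + 1) := by
        have h2 := mul_le_mul_of_nonneg_left
          (pow_mul_sub_le_pow_succ (div_nonneg hwt0 (sq_nonneg (P.card : ℝ))) hy k)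
          (sq_nonneg (P.card : ℝ))
        refine le_trans ?_ h2
        have h3 : (P.card : ℝ) ^ 2 * (y ^ k * (weightIn a P / (P.card : ℝ) ^ 2 - y)) =
            y ^ k * (weightIn a P - y * (P.card * P.card)) := by
          field_simp
        rw [h3]
        refine mul_le_mul_of_nonneg_left ?_ (by positivity)
        nlinarith [mul_le_mul_of_nonneg_left hPD (mul_nonneg hy hPpos.le)]
      have h4 : triWeight a B R / (2 * D) ≤ weightIn a P + triWeight a B Q / (2 * D) := by
        rw [div_le_iff₀ (by positivity), add_mul, div_mul_cancel₀ _ (by positivity)]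
        linarith
      calc _ ≤ c * y ^ k * ((weightIn a P - y * D * P.card) +
              (triWeight a B Q / (2 * D) - y * D * Q.card)) := by
            refine mul_le_mul_of_nonneg_left ?_ (by positivity)
            rw [hcard]
            linarith
        _ ≤ _ := by
            rw [mul_add, mul_assoc c, mul_assoc c ((P.card : ℝ) ^ 2)]
            linarith [mul_le_mul_of_nonneg_left h1 hc]

end Greedy

section Regularization

variable [DecidableEq V] {a : V → V → ℝ}

/-- Gain when no degree is much larger than `d`, the average degree of a larger graph on `n`
vertices. -/
lemma hasGain_of_bounded_degree (ha : ∀ u v, a u v = a v u)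
    (ha01 : ∀ u v, a u v = 0 ∨ a u v = 1) {B : Finset V} {c d n : ℝ} (hc : 0 < c) (k : ℕ)
    (hd : 0 < d) (hdn : d ≤ n) (hBn : (B.card : ℝ) ≤ n)
    (hdeg : ∀ u ∈ B, ∑ w ∈ B, a u w ≤ 10 * d) (hlow : 3 / 10 * (d * n) ≤ weightIn a B)
    (hpiece : ∀ w ∈ B, ∀ P ⊆ B, (∀ v ∈ P, a w v = 1) →
      HasGain a P (c * (P.card : ℝ) ^ 2 * (weightIn a P / (P.card : ℝ) ^ 2) ^ (k + 1))) :
    HasGain a B (min (1 / 25000) (c * (1 / 10 ^ 6) ^ k * (3 / 200000)) * (d ^ 2 * (d / n) ^ k)) := by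
  have hn : 0 < n := hd.trans_le hdn
  have hpow : (d / n) ^ k ≤ 1 := pow_le_one₀ (by positivity) ((div_le_one hn).2 hdn)
  rcases le_total (triWeight a B B) (d ^ 3 / 2000) with hT | hT
  · refine (hasGain_of_few_triangles ha ha01 hd hdn hBn hdeg hlow hT).mono ?_
    calc _ ≤ 1 / 25000 * (d ^ 2 * 1) :=
          mul_le_mul (min_le_left _ _) (mul_le_mul_of_nonneg_left hpow (by positivity))
            (by positivity) (by norm_num)
      _ = _ := by ring
  · refine (hasGain_of_hasGain_neighborhoods ha ha01 (D := 10 * d) (y := 1 / 10 ^ 6 * (d / n))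
      (by positivity) hc.le (by positivity) k hdeg hpiece B subset_rfl).mono ?_
    calc _ ≤ c * (1 / 10 ^ 6) ^ k * (3 / 200000) * (d ^ 2 * (d / n) ^ k) :=
          mul_le_mul_of_nonneg_right (min_le_right _ _) (by positivity)
      _ = c * (1 / 10 ^ 6 * (d / n)) ^ k * (3 / 200000 * d ^ 2) := by
          rw [mul_pow]
          ring
      _ ≤ _ := by
          refine mul_le_mul_of_nonneg_left ?_ (by positivity)
          have h1 : d ^ 2 / 40000 ≤ triWeight a B B / (2 * (10 * d)) := by
            rw [le_div_iff₀ (by positivity)]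
            linarith
          have h2 : 1 / 10 ^ 6 * (d / n) * (10 * d) * B.card ≤
              1 / 10 ^ 6 * (d / n) * (10 * d) * n :=
            mul_le_mul_of_nonneg_left hBn (by positivity)
          have h3 : 1 / 10 ^ 6 * (d / n) * (10 * d) * n = d ^ 2 / 10 ^ 5 := by
            field_simp
          linarith

/-- The gain bound passes from neighbourhoods to the whole vertex set. -/
lemma hasGain_of_neighborhoods (ha : ∀ u v, a u v = a v u)
    (ha01 : ∀ u v, a u v = 0 ∨ a u v = 1) {c : ℝ} (hc : 0 < c) (k : ℕ) (S : Finset V)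
    (hpiece : ∀ w ∈ S, ∀ P ⊆ S, (∀ v ∈ P, a w v = 1) →
      HasGain a P (c * (P.card : ℝ) ^ 2 * (weightIn a P / (P.card : ℝ) ^ 2) ^ (k + 1))) :
    HasGain a S (min (1 / 25000) (c * (1 / 10 ^ 6) ^ k * (3 / 200000)) * (S.card : ℝ) ^ 2 *
      (weightIn a S / (S.card : ℝ) ^ 2) ^ (k + 2)) := by
  have ha0 (u v : V) : 0 ≤ a u v := by rcases ha01 u v with h | h <;> simp [h]
  have ha1 (u v : V) : a u v ≤ 1 := by rcases ha01 u v with h | h <;> simp [h]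
  set c' := min (1 / 25000) (c * (1 / 10 ^ 6) ^ k * (3 / 200000)) with hc'
  have hc'0 : 0 < c' := lt_min (by norm_num) (by positivity)
  have hc'1 : c' ≤ 1 / 25000 := min_le_left _ _
  induction S using Finset.strongInduction with
  | H S ih =>
    have hwt0 (T : Finset V) : 0 ≤ weightIn a T :=
      Finset.sum_nonneg fun u _ ↦ Finset.sum_nonneg fun v _ ↦ ha0 u v
    rcases (hwt0 S).eq_or_lt with hE | hE
    · exact hasGain_of_nonpos (by rw [← hE]; simp)
    have hEn : weightIn a S ≤ (S.card : ℝ) * S.card := by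
      calc weightIn a S ≤ ∑ u ∈ S, ∑ v ∈ S, (1 : ℝ) :=
            Finset.sum_le_sum fun u _ ↦ Finset.sum_le_sum fun v _ ↦ ha1 u v
        _ = _ := by simp
    have hn : (0 : ℝ) < S.card := by
      rcases S.eq_empty_or_nonempty with h | h
      · simp [h, weightIn] at hE
      · exact_mod_cast h.card_pos
    set n : ℝ := (S.card : ℝ) with hndef
    obtain ⟨d, hdE⟩ : ∃ d, weightIn a S = d * n := ⟨weightIn a S / n, by field_simp⟩
    have hd : 0 < d := by
      rw [hdE] at hE
      exact pos_of_mul_pos_left hE hn.le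
    have hdn : d ≤ n := by
      rw [hdE] at hEn
      exact le_of_mul_le_mul_right hEn hn
    have htarget : c' * n ^ 2 * (weightIn a S / n ^ 2) ^ (k + 2) = c' * (d ^ 2 * (d / n) ^ k) := by
      rw [hdE, show d * n / n ^ 2 = d / n by field_simp, pow_add]
      field_simp
    have hpow : (d / n) ^ k ≤ 1 := pow_le_one₀ (by positivity) ((div_le_one hn).2 hdn)
    set A := S.filter fun u ↦ 10 * d < ∑ w ∈ S, a u w with hA
    set B := S.filter fun u ↦ ¬ 10 * d < ∑ w ∈ S, a u w with hB
    have hAS : A ⊆ S := Finset.filter_subset _ _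
    have hBS : B ⊆ S := Finset.filter_subset _ _
    have hdisj : Disjoint A B := Finset.disjoint_filter_filter_not _ _ _
    have hunion : A ∪ B = S := Finset.filter_union_filter_not_eq _ _
    have hsplit : weightIn a S = weightIn a A + weightIn a B + 2 * ∑ u ∈ A, ∑ v ∈ B, a u v := by
      rw [← hunion]
      exact sum_sum_union_of_symm ha hdisj
    have hBn : (B.card : ℝ) ≤ n := Nat.cast_le.2 (Finset.card_le_card hBS)
    have hAcard : (A.card : ℝ) * (10 * d) ≤ d * n := by
      calc (A.card : ℝ) * (10 * d) = ∑ u ∈ A, 10 * d := by simp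
        _ ≤ ∑ u ∈ A, ∑ w ∈ S, a u w :=
            Finset.sum_le_sum fun u hu ↦ (Finset.mem_filter.1 hu).2.le
        _ ≤ ∑ u ∈ S, ∑ w ∈ S, a u w :=
            Finset.sum_le_sum_of_subset_of_nonneg hAS fun u _ _ ↦
              Finset.sum_nonneg fun w _ ↦ ha0 u w
        _ = d * n := hdE
    have hAn : 10 * (A.card : ℝ) ≤ n := by
      refine le_of_mul_le_mul_right ?_ hd
      linarith
    rcases le_or_gt (3 / 10 * (d * n)) (weightIn a B) with hBlow | hBlow
    · rw [htarget]
      refine HasGain.subset ?_ hBS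
      refine hasGain_of_bounded_degree ha ha01 hc k hd hdn hBn (fun u hu ↦ ?_) hBlow
        fun w hw P hP ↦ hpiece w (hBS hw) P (hP.trans hBS)
      exact (Finset.sum_le_sum_of_subset_of_nonneg hBS fun v _ _ ↦ ha0 u v).trans
        (not_lt.1 (Finset.mem_filter.1 hu).2)
    rcases le_or_gt (1 / 10 * (d * n)) (weightIn a A) with hAlow | hAlow
    · have hm : (0 : ℝ) < A.card := by
        rcases A.eq_empty_or_nonempty with h | h
        · have : 0 < d * n := by positivity
          simp only [h, weightIn, Finset.sum_empty] at hAlow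
          linarith
        · exact_mod_cast h.card_pos
      have hAssub : A ⊂ S := by
        refine hAS.ssubset_of_ne fun h ↦ ?_
        rw [h] at hAn
        linarith
      refine ((ih A hAssub fun w hw P hP ↦ hpiece w (hAS hw) P (hP.trans hAS)).subset hAS).mono ?_
      rw [mul_assoc, mul_assoc]
      refine mul_le_mul_of_nonneg_left ?_ hc'0.le
      set m : ℝ := (A.card : ℝ)
      have h1 : 10 ≤ (n / m) ^ 2 / 10 := by
        have : 10 ≤ n / m := by rwa [le_div_iff₀ hm]
        nlinarith
      have h2 : (n / m) ^ 2 / 10 * (weightIn a S / n ^ 2) ≤ weightIn a A / m ^ 2 := by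
        rw [le_div_iff₀ (by positivity)]
        refine le_trans (le_of_eq ?_) (hdE ▸ hAlow)
        field_simp
      calc n ^ 2 * (weightIn a S / n ^ 2) ^ (k + 2)
          ≤ m ^ 2 * ((n / m) ^ 2 / 10) ^ (k + 2) * (weightIn a S / n ^ 2) ^ (k + 2) := by
            refine mul_le_mul_of_nonneg_right ?_ (by positivity)
            calc n ^ 2 = m ^ 2 * ((n / m) ^ 2 / 10 * 10) := by
                  field_simp
              _ ≤ m ^ 2 * ((n / m) ^ 2 / 10 * ((n / m) ^ 2 / 10)) := by
                  gcongr
              _ = m ^ 2 * ((n / m) ^ 2 / 10) ^ 2 := by ring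
              _ ≤ m ^ 2 * ((n / m) ^ 2 / 10) ^ (k + 2) := by
                  refine mul_le_mul_of_nonneg_left ?_ (by positivity)
                  exact pow_le_pow_right₀ (by linarith) (by omega)
        _ = m ^ 2 * ((n / m) ^ 2 / 10 * (weightIn a S / n ^ 2)) ^ (k + 2) := by
            rw [mul_pow, mul_assoc]
        _ ≤ m ^ 2 * (weightIn a A / m ^ 2) ^ (k + 2) := by
            gcongr
    · rw [htarget]
      have hcut := hasGain_cut ha hdisj
      rw [hunion] at hcut
      refine hcut.mono ?_
      have h1 : c' * (d ^ 2 * (d / n) ^ k) ≤ 1 / 25000 * (d ^ 2 * 1) :=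
        mul_le_mul hc'1 (mul_le_mul_of_nonneg_left hpow (by positivity))
          (by positivity) (by norm_num)
      nlinarith [mul_le_mul_of_nonneg_left hdn hd.le]

end Regularization

section CliqueFree

open Classical in
/-- The real-valued adjacency matrix of `G`. -/
noncomputable def adjWeight (G : SimpleGraph V) (u v : V) : ℝ := if G.Adj u v then 1 else 0

lemma adjWeight_symm (G : SimpleGraph V) (u v : V) : adjWeight G u v = adjWeight G v u := by
  by_cases h : G.Adj u v
  · simp [adjWeight, h, h.symm]
  · simp [adjWeight, h, mt SimpleGraph.Adj.symm h]

lemma adjWeight_eq_zero_or_one (G : SimpleGraph V) (u v : V) :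
    adjWeight G u v = 0 ∨ adjWeight G u v = 1 := by
  unfold adjWeight
  split_ifs <;> simp

lemma adjWeight_self (G : SimpleGraph V) (u : V) : adjWeight G u u = 0 := by
  simp [adjWeight]

lemma adj_of_adjWeight_eq_one {G : SimpleGraph V} {u v : V} (h : adjWeight G u v = 1) :
    G.Adj u v := by
  by_contra hadj
  simp [adjWeight, hadj] at h

open Classical in
/-- The gain of the subgraph of `G` induced on a set without a clique of size `k + 2`. -/
theorem exists_hasGain_of_no_clique (k : ℕ) :
    ∃ c : ℝ, 0 < c ∧ ∀ (V : Type) (G : SimpleGraph V) (S : Finset V),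
      (∀ K ⊆ S, ¬ G.IsNClique (k + 2) K) →
      HasGain (adjWeight G) S
        (c * (S.card : ℝ) ^ 2 * (weightIn (adjWeight G) S / (S.card : ℝ) ^ 2) ^ (k + 1)) := by
  induction k with
  | zero =>
    refine ⟨1, one_pos, fun V G S hS ↦ hasGain_of_nonpos (le_of_eq ?_)⟩
    have h0 : weightIn (adjWeight G) S = 0 := by
      refine Finset.sum_eq_zero fun u hu ↦ Finset.sum_eq_zero fun v hv ↦ ?_
      have hadj : ¬ G.Adj u v := fun hadj ↦ by
        refine hS {u, v} (by simp [Finset.insert_subset_iff, hu, hv]) ⟨?_, ?_⟩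
        · rw [Finset.coe_pair, SimpleGraph.isClique_pair]
          exact fun _ ↦ hadj
        · rw [Finset.card_pair hadj.ne]
      simp [adjWeight, hadj]
    simp [h0]
  | succ k ih =>
    obtain ⟨c, hc, hgain⟩ := ih
    refine ⟨_, lt_min (by norm_num : (0 : ℝ) < 1 / 25000)
      (by positivity : 0 < c * (1 / 10 ^ 6) ^ k * (3 / 200000)), fun V G S hS ↦ ?_⟩
    refine hasGain_of_neighborhoods (adjWeight_symm G) (adjWeight_eq_zero_or_one G) hc k S
      fun w hw P hP hwP ↦ hgain V G P fun K hK hclique ↦ ?_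
    refine hS (insert w K) (Finset.insert_subset hw (hK.trans hP)) (hclique.insert fun v hv ↦ ?_)
    exact adj_of_adjWeight_eq_one (hwP v (hK hv))

end CliqueFree

section Cuts

/-- A multilinear quadratic form on `[-1, 1]` does not increase under a suitable rounding to
`±1`. -/
lemma exists_sign_rounding [Fintype V] {a : V → V → ℝ}
    (ha : ∀ u v, a u v = a v u) (hdiag : ∀ u, a u u = 0) {f : V → ℝ} (hf : ∀ v, |f v| ≤ 1) :
    ∃ g : V → ℝ, (∀ v, g v = 1 ∨ g v = -1) ∧
      ∑ u, ∑ v, a u v * (g u * g v) ≤ ∑ u, ∑ v, a u v * (f u * f v) := by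
  classical
  suffices H : ∀ T : Finset V, ∃ g : V → ℝ, (∀ v ∈ T, g v = 1 ∨ g v = -1) ∧ (∀ v, |g v| ≤ 1) ∧
      ∑ u, ∑ v, a u v * (g u * g v) ≤ ∑ u, ∑ v, a u v * (f u * f v) by
    obtain ⟨g, hg, -, hle⟩ := H Finset.univ
    exact ⟨g, fun v ↦ hg v (Finset.mem_univ v), hle⟩
  intro T
  induction T using Finset.induction_on with
  | empty => exact ⟨f, by simp, hf, le_rfl⟩
  | insert w T hw ih =>
    obtain ⟨g, hgT, hg, hle⟩ := ih
    set L := ∑ v, a w v * g v with hL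
    obtain ⟨t, ht, htL⟩ : ∃ t : ℝ, (t = 1 ∨ t = -1) ∧ (t - g w) * L ≤ 0 := by
      have hgw := abs_le.1 (hg w)
      rcases le_total L 0 with h | h
      · exact ⟨1, Or.inl rfl, mul_nonpos_of_nonneg_of_nonpos (by linarith) h⟩
      · exact ⟨-1, Or.inr rfl, mul_nonpos_of_nonpos_of_nonneg (by linarith) h⟩
    refine ⟨Function.update g w t, fun v hv ↦ ?_, fun v ↦ ?_, ?_⟩
    · rcases eq_or_ne v w with rfl | hvw
      · simpa using ht
      · rw [Function.update_of_ne hvw]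
        exact hgT v (Finset.mem_of_mem_insert_of_ne hv hvw)
    · rcases eq_or_ne v w with rfl | hvw
      · rcases ht with rfl | rfl <;> simp
      · rw [Function.update_of_ne hvw]
        exact hg v
    · have hupd (v : V) : Function.update g w t v = g v + if v = w then t - g w else 0 := by
        rcases eq_or_ne v w with rfl | hvw <;> simp [*]
      have hexpand : ∑ u, ∑ v, a u v * (Function.update g w t u * Function.update g w t v) =
          ∑ u, ∑ v, a u v * (g u * g v) + 2 * ((t - g w) * L) := by
        have hcol : ∑ u, a u w * g u = L := Finset.sum_congr rfl fun u _ ↦ by rw [ha]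
        have (u v : V) : a u v * (Function.update g w t u * Function.update g w t v) =
            a u v * (g u * g v) + (if v = w then (t - g w) * (a u w * g u) else 0) +
            (if u = w then (t - g w) * (a w v * g v) else 0) := by
          rw [hupd, hupd]
          split_ifs with hu hv hv
          · rw [hu, hv, hdiag]
            ring
          · rw [hu]
            ring
          · rw [hv]
            ring
          · ring
        simp_rw [this, Finset.sum_add_distrib]
        rw [Finset.sum_comm (f := fun u v ↦ if u = w then (t - g w) * (a w v * g v) else 0)]
        simp only [Finset.sum_ite_eq', Finset.mem_univ, if_true, ← Finset.mul_sum]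
        rw [hcol]
        ring
      rw [hexpand]
      linarith

lemma cutSize_le_maxCut [Fintype V] (G : SimpleGraph V) (S : Finset V) :
    cutSize G S ≤ maxCut G :=
  Finset.le_sup (f := cutSize G) (Finset.mem_powerset.2 (Finset.subset_univ S))

open Classical in
lemma cutSize_eq_sum [Fintype V] (G : SimpleGraph V) (S : Finset V) :
    (cutSize G S : ℝ) = ∑ u, ∑ v, if u ∈ S ∧ v ∉ S then adjWeight G u v else 0 := by
  rw [cutSize, Nat.card_eq_fintype_card, Fintype.card_subtype, Finset.card_filter,
    ← Finset.univ_product_univ, Finset.sum_product]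
  push_cast
  refine Finset.sum_congr rfl fun u _ ↦ Finset.sum_congr rfl fun v _ ↦ ?_
  by_cases hu : u ∈ S <;> by_cases hv : v ∈ S <;> simp [hu, hv, adjWeight]

lemma weightIn_univ_eq [Fintype V] (G : SimpleGraph V) :
    weightIn (adjWeight G) Finset.univ = 2 * edgeCount G := by
  classical
  have h := G.sum_degrees_eq_twice_card_edges
  rw [edgeCount, Nat.card_eq_fintype_card, ← SimpleGraph.edgeFinset_card, weightIn]
  have hdeg (u : V) : ∑ v, adjWeight G u v = G.degree u := by
    rw [← SimpleGraph.card_neighborFinset_eq_degree, SimpleGraph.neighborFinset_eq_filter,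
      Finset.card_filter]
    push_cast
    exact Finset.sum_congr rfl fun v _ ↦ by simp [adjWeight]
  simp_rw [hdeg]
  exact_mod_cast h

lemma le_surplus_of_hasGain [Fintype V] {G : SimpleGraph V} {t : ℝ}
    (h : HasGain (adjWeight G) Finset.univ t) : t / 4 ≤ surplus G := by
  classical
  obtain ⟨f, hf, hle⟩ := h
  obtain ⟨g, hg, hgf⟩ := exists_sign_rounding (adjWeight_symm G) (adjWeight_self G) hf
  set S : Finset V := Finset.univ.filter fun v ↦ g v = 1 with hS
  have hpair (u v : V) : adjWeight G u v - adjWeight G u v * (g u * g v) =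
      2 * (if u ∈ S ∧ v ∉ S then adjWeight G u v else 0) +
      2 * (if v ∈ S ∧ u ∉ S then adjWeight G v u else 0) := by
    rw [adjWeight_symm G v u]
    rcases hg u with hu | hu <;> rcases hg v with hv | hv <;>
      norm_num [hS, hu, hv] <;> ring
  have hsum : weightIn (adjWeight G) Finset.univ - ∑ u, ∑ v, adjWeight G u v * (g u * g v) =
      4 * cutSize G S := by
    rw [weightIn, ← Finset.sum_sub_distrib]
    simp_rw [← Finset.sum_sub_distrib, hpair, Finset.sum_add_distrib, ← Finset.mul_sum]
    rw [Finset.sum_comm (f := fun u v ↦ if v ∈ S ∧ u ∉ S then adjWeight G v u else 0),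
      cutSize_eq_sum]
    ring
  rw [weightIn_univ_eq] at hsum
  have hmax : (cutSize G S : ℝ) ≤ maxCut G := by exact_mod_cast cutSize_le_maxCut G S
  rw [surplus]
  linarith

end Cuts

/-- For every `r ≥ 3` there is `c_r > 0` such that every `K_r`-free graph with `n ≥ 1`
vertices and average degree `d` has surplus at least `c_r · d^(r-1) / n^(r-3)`. -/
theorem statement4 (r : ℕ) (hr : 3 ≤ r) :
    ∃ c : ℝ, 0 < c ∧
      ∀ (V : Type) [Fintype V] (G : SimpleGraph V) (d : ℝ),
        1 ≤ Fintype.card V →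
        d = 2 * edgeCount G / Fintype.card V →
        G.CliqueFree r →
        surplus G ≥ c * d ^ (r - 1) / (Fintype.card V : ℝ) ^ (r - 3) := by
  obtain ⟨k, rfl⟩ : ∃ k, r = k + 3 := ⟨r - 3, by omega⟩
  obtain ⟨c, hc, hgain⟩ := exists_hasGain_of_no_clique (k + 1)
  refine ⟨c / 4, by positivity, fun V _ G d hV hd hfree ↦ ?_⟩
  have hn : (0 : ℝ) < Fintype.card V := by exact_mod_cast hV
  have h := le_surplus_of_hasGain (hgain V G Finset.univ fun K _ ↦ hfree K)
  refine le_of_eq_of_le ?_ h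
  rw [weightIn_univ_eq, Finset.card_univ, hd]
  have hr : k + 3 - 1 = k + 2 ∧ k + 3 - 3 = k := by omega
  rw [hr.1, hr.2]
  simp only [div_pow, ← pow_mul]
  field_simp
  ring

end MaxCutPaper
end
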